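/- arXiv:1507.00487 — 2 statements merged into one kernel-verified Lean document; each statement's English description precedes it below -/
import Mathlib

section
/- Let k ≥ 2 and let 𝒜_k, ℬ_k, 𝒞_k ⊆ ℂ be as defined via α with denominators k−1, k²−1, k²+k+1 respectively. Then |𝒜_k ∩ ℬ_k| = k−1, |𝒜_k ∩ 𝒞_k| = |ℬ_k ∩ 𝒞_k| = |𝒜_k ∩ ℬ_k ∩ 𝒞_k| = gcd(k−1,3), and consequently |𝒜_k ∪ ℬ_k ∪ 𝒞_k| = k². -/
/-- `α(σ,τ) = e^{2πiσ} + e^{2πiτ} + e^{-2πi(σ+τ)}`. -/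
noncomputable def alpha (σ τ : ℝ) : ℂ :=
  Complex.exp (2 * Real.pi * Complex.I * σ) + Complex.exp (2 * Real.pi * Complex.I * τ) +
    Complex.exp (-(2 * Real.pi * Complex.I * (σ + τ)))

/-- `𝒜_k = {α(d/(k−1), e/(k−1)) : d,e ∈ ℤ}`. -/
noncomputable def setA (k : ℕ) : Set ℂ :=
  {z : ℂ | ∃ d e : ℤ, z = alpha ((d : ℝ) / ((k : ℝ) - 1)) ((e : ℝ) / ((k : ℝ) - 1))}

/-- `ℬ_k = {α(d/(k²−1), dk/(k²−1)) : d ∈ ℤ}`. -/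
noncomputable def setB (k : ℕ) : Set ℂ :=
  {z : ℂ | ∃ d : ℤ, z = alpha ((d : ℝ) / ((k : ℝ)^2 - 1)) ((d * k : ℝ) / ((k : ℝ)^2 - 1))}

/-- `𝒞_k = {α(d/(k²+k+1), dk/(k²+k+1)) : d ∈ ℤ}`. -/
noncomputable def setC (k : ℕ) : Set ℂ :=
  {z : ℂ | ∃ d : ℤ, z = alpha ((d : ℝ) / ((k : ℝ)^2 + (k : ℝ) + 1))
    ((d * k : ℝ) / ((k : ℝ)^2 + (k : ℝ) + 1))}

/-- The triple `(x, y, (xy)⁻¹)` of complex numbers with product `1`. -/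
noncomputable def unitTriple (x y : ℂ) : Fin 3 → ℂ := ![x, y, (x * y)⁻¹]

/-- The triples with product `1` on which the `k`-th power map acts as the permutation `σ`. -/
def powTriples (k : ℕ) (σ : Equiv.Perm (Fin 3)) : Set (Fin 3 → ℂ) :=
  {t | ∏ i, t i = 1 ∧ ∀ i, t i ^ k = t (σ i)}

/-- The sums of the triples in `powTriples k σ`. -/
def powSums (k : ℕ) (σ : Equiv.Perm (Fin 3)) : Set ℂ :=
  (fun t => ∑ i, t i) '' powTriples k σ

theorem sum_unitTriple (x y : ℂ) : ∑ i, unitTriple x y i = x + y + (x * y)⁻¹ := by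
  simp [unitTriple, Fin.sum_univ_three]

theorem alpha_eq (σ τ : ℝ) :
    alpha σ τ = ∑ i, unitTriple (Complex.exp (2 * Real.pi * Complex.I * σ))
      (Complex.exp (2 * Real.pi * Complex.I * τ)) i := by
  rw [sum_unitTriple, ← Complex.exp_add, ← Complex.exp_neg, alpha]
  ring_nf

theorem exists_exp_eq_iff {n : ℕ} (hn : n ≠ 0) (x : ℂ) :
    (∃ d : ℤ, Complex.exp (2 * Real.pi * Complex.I * ((d / n : ℝ) : ℂ)) = x) ↔ x ^ n = 1 := by
  have hn' : (n : ℂ) ≠ 0 := by exact_mod_cast hn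
  constructor
  · rintro ⟨d, rfl⟩
    rw [← Complex.exp_nat_mul, Complex.exp_eq_one_iff]
    refine ⟨d, ?_⟩
    push_cast
    field_simp
  · intro h
    have : NeZero n := ⟨hn⟩
    obtain ⟨i, -, rfl⟩ := (Complex.isPrimitiveRoot_exp n hn).eq_pow_of_pow_eq_one h
    refine ⟨i, ?_⟩
    rw [← Complex.exp_nat_mul]
    congr 1
    push_cast
    field_simp

theorem ncard_pow_eq_one {n : ℕ} (hn : n ≠ 0) : {x : ℂ | x ^ n = 1}.ncard = n := by
  refine Eq.trans ?_ (Complex.isPrimitiveRoot_exp n hn).card_nthRootsFinset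
  rw [← Set.ncard_coe_finset]
  congr 1
  ext x
  simp [Polynomial.mem_nthRootsFinset (Nat.pos_of_ne_zero hn)]

section PowTriples

variable {k : ℕ}

theorem ne_zero_of_mem_powTriples {σ : Equiv.Perm (Fin 3)} {t : Fin 3 → ℂ}
    (ht : t ∈ powTriples k σ) (i : Fin 3) : t i ≠ 0 := by
  intro h
  have h1 := ht.1
  rw [Finset.prod_eq_zero (Finset.mem_univ i) h] at h1
  exact zero_ne_one h1

theorem norm_eq_one_of_mem_powTriples (hk : 2 ≤ k) {σ : Equiv.Perm (Fin 3)} {t : Fin 3 → ℂ}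
    (ht : t ∈ powTriples k σ) (i : Fin 3) : ‖t i‖ = 1 := by
  have hiter : ∀ n : ℕ, t i ^ k ^ n = t ((σ ^ n) i) := by
    intro n
    induction n with
    | zero => simp
    | succ n ih => rw [pow_succ k, pow_mul, ih, ht.2, pow_succ' σ]; rfl
  have h := hiter (orderOf σ)
  rw [pow_orderOf_eq_one] at h
  have hpos : 1 < k ^ orderOf σ := Nat.one_lt_pow (orderOf_pos σ).ne' (by omega)
  obtain ⟨m, hm⟩ : ∃ m, k ^ orderOf σ = m + 1 := ⟨k ^ orderOf σ - 1, by omega⟩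
  have h0 := ne_zero_of_mem_powTriples ht i
  rw [hm, pow_succ] at h
  have h1 : t i ^ m = 1 := mul_right_cancel₀ h0 (by simpa using h)
  exact Complex.norm_eq_one_of_pow_eq_one h1 (by omega)

theorem exists_perm_of_sum_eq {t u : Fin 3 → ℂ} (ht : ∏ i, t i = 1) (hu : ∏ i, u i = 1)
    (ht' : ∀ i, ‖t i‖ = 1) (hu' : ∀ i, ‖u i‖ = 1) (h : ∑ i, t i = ∑ i, u i) :
    ∃ g : Equiv.Perm (Fin 3), u = t ∘ g := by
  have pairs : ∀ t : Fin 3 → ℂ, ∏ i, t i = 1 → (∀ i, ‖t i‖ = 1) →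
      t 0 * t 1 + t 1 * t 2 + t 0 * t 2 = (starRingEnd ℂ) (∑ i, t i) := by
    intro t ht ht'
    have hne : ∀ i, t i ≠ 0 := fun i hi => by simpa [hi] using ht' i
    rw [map_sum, Fin.sum_univ_three, ← Complex.inv_eq_conj (ht' 0), ← Complex.inv_eq_conj (ht' 1),
      ← Complex.inv_eq_conj (ht' 2)]
    rw [Fin.prod_univ_three] at ht
    have h0 := hne 0
    have h1 := hne 1
    have h2 := hne 2
    field_simp
    linear_combination (t 0 * t 1 + t 1 * t 2 + t 0 * t 2) * ht
  have h2 : t 0 * t 1 + t 1 * t 2 + t 0 * t 2 = u 0 * u 1 + u 1 * u 2 + u 0 * u 2 := by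
    rw [pairs t ht ht', pairs u hu hu', h]
  rw [Fin.prod_univ_three] at ht hu
  rw [Fin.sum_univ_three, Fin.sum_univ_three] at h
  have hne : u 0 ≠ 0 := fun hi => by simpa [hi] using hu' 0
  have key : ∀ a b c : ℂ, a + b + c = u 0 + u 1 + u 2 → a * b * c = 1 → u 0 = a →
      (u 1 = b ∧ u 2 = c) ∨ (u 1 = c ∧ u 2 = b) := by
    intro a b c hs hp ha
    subst ha
    have hbc : b * c = u 1 * u 2 := mul_left_cancel₀ hne (by linear_combination hp - hu)
    have hprod : (u 1 - b) * (u 1 - c) = 0 := by linear_combination hbc - u 1 * hs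
    rcases mul_eq_zero.1 hprod with h' | h'
    · exact Or.inl ⟨by linear_combination h', by linear_combination -hs - h'⟩
    · exact Or.inr ⟨by linear_combination h', by linear_combination -hs - h'⟩
  have hroot : (u 0 - t 0) * ((u 0 - t 1) * (u 0 - t 2)) = 0 := by
    linear_combination u 0 * h2 - u 0 ^ 2 * h - ht + hu
  have finish : ∀ g : Equiv.Perm (Fin 3), u 0 = t (g 0) → u 1 = t (g 1) → u 2 = t (g 2) →
      ∃ g : Equiv.Perm (Fin 3), u = t ∘ g := by
    intro g h0 h1 h2
    refine ⟨g, funext fun i => ?_⟩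
    fin_cases i
    exacts [h0, h1, h2]
  rcases mul_eq_zero.1 hroot with h0 | h0
  · have h0 := sub_eq_zero.1 h0
    rcases key _ (t 1) (t 2) h ht h0 with ⟨ha, hb⟩ | ⟨ha, hb⟩
    · exact finish 1 h0 ha hb
    · exact finish (Equiv.swap 1 2) h0 ha hb
  · rcases mul_eq_zero.1 h0 with h0 | h0
    · have h0 := sub_eq_zero.1 h0
      rcases key _ (t 0) (t 2) (by linear_combination h) (by linear_combination ht) h0 with
        ⟨ha, hb⟩ | ⟨ha, hb⟩
      · exact finish (Equiv.swap 0 1) h0 ha hb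
      · exact finish (finRotate 3) h0 ha hb
    · have h0 := sub_eq_zero.1 h0
      rcases key _ (t 0) (t 1) (by linear_combination h) (by linear_combination ht) h0 with
        ⟨ha, hb⟩ | ⟨ha, hb⟩
      · exact finish (finRotate 3)⁻¹ h0 ha hb
      · exact finish (Equiv.swap 0 2) h0 ha hb

theorem exists_perm_of_mem_powTriples (hk : 2 ≤ k) {σ τ : Equiv.Perm (Fin 3)} {t u : Fin 3 → ℂ}
    (ht : t ∈ powTriples k σ) (hu : u ∈ powTriples k τ) (h : ∑ i, t i = ∑ i, u i) :
    ∃ g : Equiv.Perm (Fin 3), u = t ∘ g :=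
  exists_perm_of_sum_eq ht.1 hu.1 (norm_eq_one_of_mem_powTriples hk ht)
    (norm_eq_one_of_mem_powTriples hk hu) h

theorem comp_mem_powTriples {σ : Equiv.Perm (Fin 3)} {t : Fin 3 → ℂ} (ht : t ∈ powTriples k σ)
    (g : Equiv.Perm (Fin 3)) : t ∘ g ∈ powTriples k (g⁻¹ * σ * g) := by
  refine ⟨by simpa using (Equiv.prod_comp g t).trans ht.1, fun i => ?_⟩
  simp [ht.2]

theorem image_comp_powTriples (k : ℕ) (σ g : Equiv.Perm (Fin 3)) :
    (fun t : Fin 3 → ℂ => t ∘ g) '' powTriples k σ = powTriples k (g⁻¹ * σ * g) := by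
  refine Set.Subset.antisymm ?_ fun t ht => ?_
  · rintro _ ⟨t, ht, rfl⟩
    exact comp_mem_powTriples ht g
  · refine ⟨t ∘ (g⁻¹ : Equiv.Perm (Fin 3)), ?_, ?_⟩
    · simpa [mul_assoc] using comp_mem_powTriples ht g⁻¹
    · ext i
      simp

theorem ncard_powTriples_conj (k : ℕ) (σ g : Equiv.Perm (Fin 3)) :
    (powTriples k (g⁻¹ * σ * g)).ncard = (powTriples k σ).ncard := by
  rw [← image_comp_powTriples]
  exact Set.ncard_image_of_injective _ g.surjective.injective_comp_right

theorem powSums_conj (k : ℕ) (σ g : Equiv.Perm (Fin 3)) :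
    powSums k (g⁻¹ * σ * g) = powSums k σ := by
  rw [powSums, powSums, ← image_comp_powTriples, Set.image_image]
  exact Set.image_congr fun t _ => Equiv.sum_comp g t

theorem injective_unitTriple_left (f : ℂ → ℂ) : Function.Injective fun x => unitTriple x (f x) :=
  fun _ _ h => congrFun h 0

theorem mem_powTriples_iff {σ : Equiv.Perm (Fin 3)} {t : Fin 3 → ℂ} : t ∈ powTriples k σ ↔
    t 0 * t 1 * t 2 = 1 ∧ t 0 ^ k = t (σ 0) ∧ t 1 ^ k = t (σ 1) ∧ t 2 ^ k = t (σ 2) := by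
  simp [powTriples, Fin.prod_univ_three, Fin.forall_fin_succ]

theorem eq_unitTriple {t : Fin 3 → ℂ} (h : t 0 * t 1 * t 2 = 1) : unitTriple (t 0) (t 1) = t := by
  ext i
  fin_cases i
  · rfl
  · rfl
  · exact inv_eq_of_mul_eq_one_right h

theorem pow_eq_self_iff (hk : 2 ≤ k) {x : ℂ} (hx : x ≠ 0) : x ^ k = x ↔ x ^ (k - 1) = 1 := by
  obtain ⟨m, rfl⟩ : ∃ m, k = m + 1 := ⟨k - 1, by omega⟩
  rw [Nat.add_sub_cancel, pow_succ, mul_eq_right₀ hx]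

theorem powTriples_one (hk : 2 ≤ k) : powTriples k 1 =
    (fun p : ℂ × ℂ => unitTriple p.1 p.2) '' ({x | x ^ (k - 1) = 1} ×ˢ {x | x ^ (k - 1) = 1}) := by
  ext t
  constructor
  · intro ht
    have hne := ne_zero_of_mem_powTriples ht
    exact ⟨(t 0, t 1), ⟨(pow_eq_self_iff hk (hne 0)).1 (ht.2 0),
      (pow_eq_self_iff hk (hne 1)).1 (ht.2 1)⟩, eq_unitTriple (mem_powTriples_iff.1 ht).1⟩
  · rintro ⟨⟨x, y⟩, ⟨hx, hy⟩, rfl⟩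
    simp only [Set.mem_ofPred_eq] at hx hy
    have hx0 : x ≠ 0 := by rintro rfl; simp [show k - 1 ≠ 0 by omega] at hx
    have hy0 : y ≠ 0 := by rintro rfl; simp [show k - 1 ≠ 0 by omega] at hy
    have hx' := (pow_eq_self_iff hk hx0).2 hx
    have hy' := (pow_eq_self_iff hk hy0).2 hy
    refine mem_powTriples_iff.2 ?_
    simp [unitTriple, hx', hy', mul_pow]
    field_simp

theorem powTriples_swap (hk : 2 ≤ k) : powTriples k (Equiv.swap 0 1) =
    (fun x : ℂ => unitTriple x (x ^ k)) '' {x | x ^ (k ^ 2 - 1) = 1} := by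
  have hk2 : 2 ≤ k ^ 2 := by nlinarith
  ext t
  constructor
  · intro ht
    have hne := ne_zero_of_mem_powTriples ht
    have h0 : t 0 ^ k = t 1 := ht.2 0
    have h1 : t 1 ^ k = t 0 := ht.2 1
    refine ⟨t 0, ?_, ?_⟩
    · exact (pow_eq_self_iff hk2 (hne 0)).1 (by rw [pow_two, pow_mul, h0, h1])
    · simp only [h0]
      exact eq_unitTriple (mem_powTriples_iff.1 ht).1
  · rintro ⟨x, hx, rfl⟩
    simp only [Set.mem_ofPred_eq] at hx
    have hx0 : x ≠ 0 := by rintro rfl; simp [show k ^ 2 - 1 ≠ 0 by omega] at hx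
    have hx' : (x ^ k) ^ k = x := by
      rw [← pow_mul, ← pow_two]
      exact (pow_eq_self_iff hk2 hx0).2 hx
    refine mem_powTriples_iff.2 ⟨?_, rfl, hx', ?_⟩
    · simp [unitTriple]
      field_simp
    · have : (Equiv.swap 0 1 : Equiv.Perm (Fin 3)) 2 = 2 := by decide
      simp [unitTriple, this, mul_pow, hx', mul_comm]

theorem powTriples_finRotate (k : ℕ) : powTriples k (finRotate 3) =
    (fun x : ℂ => unitTriple x (x ^ k)) '' {x | x ^ (k ^ 2 + k + 1) = 1} := by
  ext t
  constructor
  · intro ht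
    have h0 : t 0 ^ k = t 1 := ht.2 0
    have h1 : t 1 ^ k = t 2 := ht.2 1
    have hp := (mem_powTriples_iff.1 ht).1
    refine ⟨t 0, ?_, ?_⟩
    · rw [← h1, ← h0] at hp
      simp only [Set.mem_ofPred_eq]
      rw [← hp]
      ring
    · simp only [h0]
      exact eq_unitTriple hp
  · rintro ⟨x, hx, rfl⟩
    simp only [Set.mem_ofPred_eq] at hx
    have hx0 : x ≠ 0 := by rintro rfl; simp at hx
    have hx' : (x * x ^ k)⁻¹ = (x ^ k) ^ k := by
      refine inv_eq_of_mul_eq_one_right ?_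
      rw [← hx]
      ring
    have hx3 : ((x ^ k) ^ k) ^ k = x := by
      have h2 : x * ((x ^ k) * (x ^ k) ^ k) = 1 := by rw [← hx]; ring
      have h3 : x ^ k * ((x ^ k) ^ k * ((x ^ k) ^ k) ^ k) = 1 := by
        rw [← mul_pow, ← mul_pow, h2, one_pow]
      have h4 : x ^ k * (x ^ k) ^ k ≠ 0 := by positivity
      refine mul_left_cancel₀ h4 ?_
      linear_combination h3 - h2
    refine mem_powTriples_iff.2 ⟨?_, rfl, hx'.symm, ?_⟩
    · simp [unitTriple]
      field_simp
    · change ((x * x ^ k)⁻¹) ^ k = x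
      rw [hx', hx3]

theorem ncard_powTriples_one (hk : 2 ≤ k) : (powTriples k 1).ncard = (k - 1) ^ 2 := by
  rw [powTriples_one hk, Set.ncard_image_of_injective, Set.ncard_prod,
    ncard_pow_eq_one (by omega), pow_two]
  rintro ⟨x, y⟩ ⟨x', y'⟩ h
  exact Prod.ext (congrFun h 0) (congrFun h 1)

theorem ncard_powTriples_swap (hk : 2 ≤ k) :
    (powTriples k (Equiv.swap 0 1)).ncard = k ^ 2 - 1 := by
  have hk2 : 2 ≤ k ^ 2 := by nlinarith
  rw [powTriples_swap hk, Set.ncard_image_of_injective _ (injective_unitTriple_left _),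
    ncard_pow_eq_one (by omega)]

theorem ncard_powTriples_finRotate (k : ℕ) :
    (powTriples k (finRotate 3)).ncard = k ^ 2 + k + 1 := by
  rw [powTriples_finRotate k, Set.ncard_image_of_injective _ (injective_unitTriple_left _),
    ncard_pow_eq_one (by omega)]

theorem perm_fin_three_conj (σ : Equiv.Perm (Fin 3)) :
    σ = 1 ∨ (∃ g : Equiv.Perm (Fin 3), σ = g⁻¹ * Equiv.swap 0 1 * g) ∨
      ∃ g : Equiv.Perm (Fin 3), σ = g⁻¹ * finRotate 3 * g := by
  revert σ
  decide

theorem finite_powTriples (hk : 2 ≤ k) (σ : Equiv.Perm (Fin 3)) : (powTriples k σ).Finite := by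
  refine Set.finite_of_ncard_ne_zero ?_
  have hk2 : 2 ≤ k ^ 2 := by nlinarith
  rcases perm_fin_three_conj σ with rfl | ⟨g, rfl⟩ | ⟨g, rfl⟩
  · rw [ncard_powTriples_one hk]
    exact pow_ne_zero _ (by omega)
  · rw [ncard_powTriples_conj, ncard_powTriples_swap hk]
    omega
  · rw [ncard_powTriples_conj, ncard_powTriples_finRotate k]
    omega

theorem sum_ncard_powTriples (hk : 2 ≤ k) : ∑ σ, (powTriples k σ).ncard = 6 * k ^ 2 := by
  have huniv : (Finset.univ : Finset (Equiv.Perm (Fin 3))) =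
      {1, Equiv.swap 0 1, (Equiv.swap 1 2)⁻¹ * Equiv.swap 0 1 * Equiv.swap 1 2,
        (Equiv.swap 0 2)⁻¹ * Equiv.swap 0 1 * Equiv.swap 0 2, finRotate 3,
        (Equiv.swap 0 1)⁻¹ * finRotate 3 * Equiv.swap 0 1} := by decide
  rw [huniv, Finset.sum_insert (by decide), Finset.sum_insert (by decide),
    Finset.sum_insert (by decide), Finset.sum_insert (by decide), Finset.sum_insert (by decide),
    Finset.sum_singleton]
  simp only [ncard_powTriples_conj, ncard_powTriples_one hk, ncard_powTriples_swap hk,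
    ncard_powTriples_finRotate k]
  obtain ⟨m, rfl⟩ : ∃ m, k = m + 1 := ⟨k - 1, by omega⟩
  have : (m + 1) ^ 2 - 1 = m ^ 2 + 2 * m := by
    rw [show (m + 1) ^ 2 = m ^ 2 + 2 * m + 1 by ring, Nat.add_sub_cancel]
  rw [this, Nat.add_sub_cancel]
  ring

/-- Rearrangements `t` of `s` together with a permutation `σ` inducing the power map on `t` are
equinumerous with permutations of the three indices. -/
theorem card_rearrangements {s : Fin 3 → ℂ} {τ : Equiv.Perm (Fin 3)} (hs : s ∈ powTriples k τ)
    (O : Finset (Fin 3 → ℂ)) (hO : ∀ t, t ∈ O ↔ ∃ g : Equiv.Perm (Fin 3), t = s ∘ g) :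
    ∑ t ∈ O, {σ | t ∈ powTriples k σ}.ncard = 6 := by
  classical
  have hfiber : ∀ t ∈ O, {σ | t ∈ powTriples k σ}.ncard =
      (Finset.univ.filter fun g : Equiv.Perm (Fin 3) => s ∘ g = t).card := by
    intro t ht
    obtain ⟨g, rfl⟩ := (hO t).1 ht
    have hmem := comp_mem_powTriples hs g
    rw [← Set.ncard_coe_finset]
    have himage : {σ | s ∘ g ∈ powTriples k σ} = (fun h => g⁻¹ * h * (g⁻¹ * τ * g)) ''
        ((Finset.univ.filter fun h : Equiv.Perm (Fin 3) => s ∘ h = s ∘ g : Finset _) : Set _) := by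
      ext σ
      constructor
      · intro hσ
        refine ⟨g * σ * (g⁻¹ * τ * g)⁻¹, ?_, by group⟩
        simp only [Finset.coe_filter, Finset.mem_univ, true_and, Set.mem_ofPred_eq]
        ext i
        have h1 := hσ.2 ((g⁻¹ * τ * g)⁻¹ i)
        rw [hmem.2, ← Equiv.Perm.mul_apply, mul_inv_cancel] at h1
        exact h1.symm
      · rintro ⟨h, hh, rfl⟩
        simp only [Finset.coe_filter, Finset.mem_univ, true_and, Set.mem_ofPred_eq] at hh
        refine ⟨hmem.1, fun i => ?_⟩
        have h1 := congrFun hh ((g⁻¹ * τ * g) i)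
        rw [hmem.2, ← h1]
        simp
    rw [himage, Set.ncard_image_of_injective]
    intro a b hab
    simpa using hab
  rw [Finset.sum_congr rfl hfiber, ← Finset.card_eq_sum_card_fiberwise
    fun g _ => (hO _).2 ⟨g, rfl⟩]
  simp [Fintype.card_perm]
  rfl

theorem ncard_iUnion_powSums (hk : 2 ≤ k) : (⋃ σ, powSums k σ).ncard = k ^ 2 := by
  classical
  set T : Finset (Fin 3 → ℂ) := Finset.univ.biUnion fun σ => (finite_powTriples hk σ).toFinset
    with hT
  have hmemT : ∀ t, t ∈ T ↔ ∃ σ, t ∈ powTriples k σ := by simp [hT]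
  have hU : (⋃ σ, powSums k σ) = ((T.image fun t => ∑ i, t i : Finset ℂ) : Set ℂ) := by
    ext z
    simp only [Set.mem_iUnion, powSums, Set.mem_image, Finset.coe_image, Finset.mem_coe, hmemT]
    exact ⟨fun ⟨σ, t, ht, hz⟩ => ⟨t, ⟨σ, ht⟩, hz⟩, fun ⟨t, ⟨σ, ht⟩, hz⟩ => ⟨σ, t, ht, hz⟩⟩
  have hcount : ∑ σ, (powTriples k σ).ncard = ∑ t ∈ T, {σ | t ∈ powTriples k σ}.ncard := by
    have h := Finset.sum_card_bipartiteAbove_eq_sum_card_bipartiteBelow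
      (s := (Finset.univ : Finset (Equiv.Perm (Fin 3)))) (t := T) fun σ t => t ∈ powTriples k σ
    convert h using 2 with σ _ t _
    · rw [← Set.ncard_coe_finset]
      congr 1
      ext t
      simpa [Finset.bipartiteAbove, hmemT] using fun ht => ⟨σ, ht⟩
    · rw [← Set.ncard_coe_finset]
      congr 1
      ext σ
      simp [Finset.bipartiteBelow]
  have hfiber : ∀ z ∈ T.image (fun t => ∑ i, t i),
      ∑ t ∈ T with ∑ i, t i = z, {σ | t ∈ powTriples k σ}.ncard = 6 := by
    intro z hz
    obtain ⟨s, hs, rfl⟩ := Finset.mem_image.1 hz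
    obtain ⟨τ, hs⟩ := (hmemT s).1 hs
    refine card_rearrangements hs _ fun t => ?_
    rw [Finset.mem_filter, hmemT]
    constructor
    · rintro ⟨⟨σ, ht⟩, h⟩
      exact exists_perm_of_mem_powTriples hk hs ht h.symm
    · rintro ⟨g, rfl⟩
      exact ⟨⟨_, comp_mem_powTriples hs g⟩, Equiv.sum_comp g s⟩
  rw [sum_ncard_powTriples hk, ← Finset.sum_fiberwise_of_maps_to
    (fun t ht => Finset.mem_image_of_mem (fun t => ∑ i, t i) ht),
    Finset.sum_congr rfl hfiber, Finset.sum_const, smul_eq_mul] at hcount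
  rw [hU, Set.ncard_coe_finset]
  omega

theorem iUnion_powSums (k : ℕ) : (⋃ σ, powSums k σ) =
    powSums k 1 ∪ powSums k (Equiv.swap 0 1) ∪ powSums k (finRotate 3) := by
  refine Set.Subset.antisymm (Set.iUnion_subset fun σ => ?_) ?_
  · rcases perm_fin_three_conj σ with rfl | ⟨g, rfl⟩ | ⟨g, rfl⟩
    · exact fun z hz => Or.inl (Or.inl hz)
    · rw [powSums_conj]
      exact fun z hz => Or.inl (Or.inr hz)
    · rw [powSums_conj]
      exact fun z hz => Or.inr hz
  · exact Set.union_subset (Set.union_subset (Set.subset_iUnion _ _) (Set.subset_iUnion _ _))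
      (Set.subset_iUnion _ _)

/-- If the sum of a triple permuted by `τ` is also the sum of a triple permuted by `σ`, then the
former is also permuted by a conjugate of `σ`. -/
theorem exists_mem_powTriples_of_mem_powSums (hk : 2 ≤ k) {σ τ : Equiv.Perm (Fin 3)} {z : ℂ}
    (hσ : z ∈ powSums k σ) (hτ : z ∈ powSums k τ) :
    ∃ u ∈ powTriples k τ, ∑ i, u i = z ∧ ∃ g : Equiv.Perm (Fin 3),
      u ∈ powTriples k (g⁻¹ * σ * g) := by
  obtain ⟨t, ht, rfl⟩ := hσ
  obtain ⟨u, hu, h⟩ := hτ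
  obtain ⟨g, rfl⟩ := exists_perm_of_mem_powTriples hk ht hu h.symm
  exact ⟨_, hu, h, g, comp_mem_powTriples ht g⟩

theorem powSums_one_inter_swap (hk : 2 ≤ k) : powSums k 1 ∩ powSums k (Equiv.swap 0 1) =
    (fun x => ∑ i, unitTriple x x i) '' {x | x ^ (k - 1) = 1} := by
  ext z
  constructor
  · rintro ⟨h1, h2⟩
    obtain ⟨u, hu, rfl, g, hg⟩ := exists_mem_powTriples_of_mem_powSums hk h1 h2
    have hg1 : u ∈ powTriples k 1 := by simpa using hg
    have h0 : u 0 ^ k = u 0 := hg1.2 0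
    have h01 : u 0 = u 1 := h0.symm.trans (hu.2 0)
    refine ⟨u 0, (pow_eq_self_iff hk (ne_zero_of_mem_powTriples hu 0)).1 h0, ?_⟩
    have h := eq_unitTriple (mem_powTriples_iff.1 hu).1
    rw [← h01] at h
    simp only [h]
  · rintro ⟨x, hx, rfl⟩
    have ht : unitTriple x x ∈ powTriples k 1 := by
      rw [powTriples_one hk]
      exact ⟨(x, x), ⟨hx, hx⟩, rfl⟩
    refine ⟨⟨_, ht, rfl⟩, ⟨_, ⟨ht.1, fun i => (ht.2 i).trans ?_⟩, rfl⟩⟩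
    fin_cases i <;> rfl

theorem ncard_powSums_one_inter_swap (hk : 2 ≤ k) :
    (powSums k 1 ∩ powSums k (Equiv.swap 0 1)).ncard = k - 1 := by
  rw [powSums_one_inter_swap hk, Set.InjOn.ncard_image, ncard_pow_eq_one (by omega)]
  have hmem : ∀ x : ℂ, x ^ (k - 1) = 1 → unitTriple x x ∈ powTriples k 1 := by
    intro x hx
    rw [powTriples_one hk]
    exact ⟨(x, x), ⟨hx, hx⟩, rfl⟩
  intro x hx y hy hxy
  obtain ⟨g, hg⟩ := exists_perm_of_mem_powTriples hk (hmem x hx) (hmem y hy) hxy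
  have hdec : ∀ g : Equiv.Perm (Fin 3), g 0 = 0 ∨ g 0 = 1 ∨ g 1 = 0 ∨ g 1 = 1 := by decide
  have h0 : y = unitTriple x x (g 0) := congrFun hg 0
  have h1 : y = unitTriple x x (g 1) := congrFun hg 1
  rcases hdec g with h | h | h | h
  · rw [h] at h0; exact h0.symm
  · rw [h] at h0; exact h0.symm
  · rw [h] at h1; exact h1.symm
  · rw [h] at h1; exact h1.symm

theorem image_three_mul_subset_powSums (hk : 2 ≤ k) (σ : Equiv.Perm (Fin 3)) :
    (fun x : ℂ => 3 * x) '' {x | x ^ Nat.gcd (k - 1) 3 = 1} ⊆ powSums k σ := by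
  rintro _ ⟨x, hx, rfl⟩
  obtain ⟨hx1, hx3⟩ := pow_gcd_eq_one.1 hx
  have hx0 : x ≠ 0 := by rintro rfl; simp at hx3
  exact ⟨fun _ => x, ⟨by simpa using hx3, fun _ => (pow_eq_self_iff hk hx0).2 hx1⟩, by simp⟩

theorem powSums_inter_finRotate (hk : 2 ≤ k) {σ : Equiv.Perm (Fin 3)} {i : Fin 3}
    (hi : σ i = i) : powSums k σ ∩ powSums k (finRotate 3) =
      (fun x : ℂ => 3 * x) '' {x | x ^ Nat.gcd (k - 1) 3 = 1} := by
  refine Set.Subset.antisymm ?_ (Set.subset_inter (image_three_mul_subset_powSums hk _)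
    (image_three_mul_subset_powSums hk _))
  rintro z ⟨h1, h2⟩
  obtain ⟨u, hu, rfl, g, hg⟩ := exists_mem_powTriples_of_mem_powSums hk h1 h2
  have hfix : u (g⁻¹ i) ^ k = u (g⁻¹ i) := by
    rw [hg.2]
    simp [hi]
  obtain ⟨h, h01, h12, h20⟩ := mem_powTriples_iff.1 hu
  change u 0 ^ k = u 1 at h01
  change u 1 ^ k = u 2 at h12
  change u 2 ^ k = u 0 at h20
  have hconst : u 0 = u 1 ∧ u 0 = u 2 := by
    generalize g⁻¹ i = j at hfix
    fin_cases j
    · change u 0 ^ k = u 0 at hfix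
      have h' : u 0 = u 1 := hfix.symm.trans h01
      exact ⟨h', by rw [← h12, ← h', hfix]⟩
    · change u 1 ^ k = u 1 at hfix
      have h' : u 1 = u 2 := hfix.symm.trans h12
      have h'' : u 0 = u 1 := by rw [← h20, ← h', hfix]
      exact ⟨h'', h''.trans h'⟩
    · change u 2 ^ k = u 2 at hfix
      have h' : u 2 = u 0 := hfix.symm.trans h20
      exact ⟨by rw [← h01, ← h', hfix], h'.symm⟩
  obtain ⟨ha, hb⟩ := hconst
  rw [← ha] at h01
  rw [← ha, ← hb] at h
  refine ⟨u 0, pow_gcd_eq_one.2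
    ⟨(pow_eq_self_iff hk (ne_zero_of_mem_powTriples hu 0)).1 h01, ?_⟩, ?_⟩
  · rw [← h]
    ring
  · simp only [Fin.sum_univ_three, ← ha, ← hb]
    ring

theorem ncard_image_three_mul (k : ℕ) :
    ((fun x : ℂ => 3 * x) '' {x | x ^ Nat.gcd (k - 1) 3 = 1}).ncard = Nat.gcd (k - 1) 3 := by
  rw [Set.ncard_image_of_injective _ (mul_right_injective₀ three_ne_zero),
    ncard_pow_eq_one (Nat.gcd_pos_of_pos_right _ three_pos).ne']

theorem setA_eq_powSums (hk : 2 ≤ k) : setA k = powSums k 1 := by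
  have hcast : (k : ℝ) - 1 = ((k - 1 : ℕ) : ℝ) := by
    rw [Nat.cast_sub (by omega), Nat.cast_one]
  have hroot := exists_exp_eq_iff (n := k - 1) (by omega)
  rw [powSums, powTriples_one hk, Set.image_image]
  ext z
  constructor
  · rintro ⟨d, e, rfl⟩
    rw [hcast, alpha_eq]
    exact ⟨(_, _), ⟨(hroot _).1 ⟨d, rfl⟩, (hroot _).1 ⟨e, rfl⟩⟩, rfl⟩
  · rintro ⟨⟨x, y⟩, ⟨hx, hy⟩, rfl⟩
    obtain ⟨d, rfl⟩ := (hroot x).2 hx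
    obtain ⟨e, rfl⟩ := (hroot y).2 hy
    refine ⟨d, e, ?_⟩
    rw [hcast, alpha_eq]

theorem setOf_alpha_eq_image (k : ℕ) {n : ℕ} (hn : n ≠ 0) :
    {z : ℂ | ∃ d : ℤ, z = alpha ((d : ℝ) / n) ((d * k : ℝ) / n)} =
      (fun x => ∑ i, unitTriple x (x ^ k) i) '' {x | x ^ n = 1} := by
  have hpow : ∀ d : ℤ, alpha ((d : ℝ) / n) ((d * k : ℝ) / n) =
      ∑ i, unitTriple (Complex.exp (2 * Real.pi * Complex.I * ((d / n : ℝ) : ℂ)))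
        (Complex.exp (2 * Real.pi * Complex.I * ((d / n : ℝ) : ℂ)) ^ k) i := by
    intro d
    have harg : 2 * Real.pi * Complex.I * ((d * k / n : ℝ) : ℂ) =
        k * (2 * Real.pi * Complex.I * ((d / n : ℝ) : ℂ)) := by
      push_cast
      ring
    rw [alpha_eq, harg, Complex.exp_nat_mul]
  ext z
  constructor
  · rintro ⟨d, rfl⟩
    exact ⟨_, (exists_exp_eq_iff hn _).1 ⟨d, rfl⟩, (hpow d).symm⟩
  · rintro ⟨x, hx, rfl⟩
    obtain ⟨d, rfl⟩ := (exists_exp_eq_iff hn x).2 hx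
    exact ⟨d, (hpow d).symm⟩

theorem setB_eq_powSums (hk : 2 ≤ k) : setB k = powSums k (Equiv.swap 0 1) := by
  have hk2 : 2 ≤ k ^ 2 := by nlinarith
  have hcast : (k : ℝ) ^ 2 - 1 = ((k ^ 2 - 1 : ℕ) : ℝ) := by
    rw [Nat.cast_sub (by omega), Nat.cast_pow, Nat.cast_one]
  rw [powSums, powTriples_swap hk, Set.image_image, setB, hcast]
  exact setOf_alpha_eq_image k (by omega)

theorem setC_eq_powSums (k : ℕ) : setC k = powSums k (finRotate 3) := by
  have hcast : (k : ℝ) ^ 2 + k + 1 = ((k ^ 2 + k + 1 : ℕ) : ℝ) := by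
    push_cast
    ring
  rw [powSums, powTriples_finRotate k, Set.image_image, setC, hcast]
  exact setOf_alpha_eq_image k (by omega)

end PowTriples

theorem card_intersections_and_union (k : ℕ) (hk : 2 ≤ k) :
    (setA k ∩ setB k).ncard = k - 1 ∧
    (setA k ∩ setC k).ncard = Nat.gcd (k - 1) 3 ∧
    (setB k ∩ setC k).ncard = Nat.gcd (k - 1) 3 ∧
    (setA k ∩ setB k ∩ setC k).ncard = Nat.gcd (k - 1) 3 ∧
    (setA k ∪ setB k ∪ setC k).ncard = k ^ 2 := by
  have hAC := powSums_inter_finRotate hk (σ := 1) (i := 0) rfl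
  have hBC := powSums_inter_finRotate hk (σ := Equiv.swap 0 1) (i := 2) (by decide)
  rw [setA_eq_powSums hk, setB_eq_powSums hk, setC_eq_powSums, Set.inter_assoc, hAC, hBC,
    Set.inter_eq_right.2 (image_three_mul_subset_powSums hk 1), ← iUnion_powSums]
  exact ⟨ncard_powSums_one_inter_swap hk, ncard_image_three_mul k, ncard_image_three_mul k,
    ncard_image_three_mul k, ncard_iUnion_powSums hk⟩
end

section
/- Let q be a prime power and k a positive integer. Set a = (q−1)/gcd(k,q−1), b = (q²−1)/gcd(k,q²−1), c = (q²+q+1)/gcd(k,q²+q+1). Then the value set of the bivariate Chebyshev map 𝒯_k(x,y) = (g_k(x,y), g_k(y,x)) on 𝔽_q² has cardinality a²/6 + b/2 + c/3 + η(k,q), where η(k,q) = 0 if (3∤k or 3∤a) and (2∤k or 2∤b); η = 2/3 if 3|k, 3|a and (2∤k or 2∤b); η = a/2 if (3∤k or 3∤a) and 2|k, 2|b; and η = a/2 + 2/3 if 3|k, 3|a, 2|k, 2|b. In particular, 𝒯_k is a bijection of 𝔽_q² iff gcd(k, q^s − 1) = 1 for s = 1, 2, 3. -/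
/-- `chebAux n x y = g_{n-1}(x,y)` where `g_{-1}=y`, `g_0=3`, `g_1=x`,
`g_k = x g_{k-1} - y g_{k-2} + g_{k-3}`, over any commutative ring. -/
def chebAux {R : Type*} [CommRing R] : ℕ → R → R → R
  | 0, _, y => y
  | 1, _, _ => 3
  | 2, x, _ => x
  | (n+3), x, y => x * chebAux (n+2) x y - y * chebAux (n+1) x y + chebAux n x y

/-- The bivariate Chebyshev polynomial `g_k` as a function, for `k ≥ 0`. -/
def g {R : Type*} [CommRing R] (k : ℕ) (x y : R) : R := chebAux (k+1) x y

/-- The bivariate Chebyshev map `𝒯_k(x,y) = (g_k(x,y), g_k(y,x))`. -/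
def T {R : Type*} [CommRing R] (k : ℕ) (p : R × R) : R × R := (g k p.1 p.2, g k p.2 p.1)

section PowerSums

variable {R : Type*} [CommRing R]

theorem chebAux_symm (u v w : R) (h : u * v * w = 1) (n : ℕ) :
    chebAux (n + 1) (u + v + w) (u * v + v * w + w * u) = u ^ n + v ^ n + w ^ n := by
  induction n using Nat.strong_induction_on with
  | _ n ih =>
    match n, ih with
    | 0, _ => simp only [chebAux]; ring
    | 1, _ => simp [chebAux]
    | 2, _ => simp only [chebAux]; ring
    | m + 3, ih =>
      rw [show m + 3 + 1 = (m + 1) + 3 from rfl, chebAux, ih (m + 2) (by omega),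
        ih (m + 1) (by omega), ih m (by omega)]
      linear_combination (-u ^ m - v ^ m - w ^ m) * h

/-- The first two elementary symmetric functions of three elements. -/
def esymmPair (u v w : R) : R × R := (u + v + w, u * v + v * w + w * u)

theorem T_esymmPair (k : ℕ) (u v w : R) (h : u * v * w = 1) :
    T k (esymmPair u v w) = esymmPair (u ^ k) (v ^ k) (w ^ k) := by
  have h2 : (u * v) * (v * w) * (w * u) = 1 := by
    linear_combination (u * v * w + 1) * h
  have h1 := chebAux_symm _ _ _ h2 k
  rw [show u * v * (v * w) + v * w * (w * u) + w * u * (u * v) = u + v + w by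
    linear_combination (u + v + w) * h] at h1
  simp only [T, g, esymmPair, chebAux_symm u v w h k, h1, mul_pow]

theorem map_T {S : Type*} [CommRing S] (f : R →+* S) (k : ℕ) (p : R × R) :
    T k (f p.1, f p.2) = (f (T k p).1, f (T k p).2) := by
  have key : ∀ (n : ℕ) (x y : R), chebAux n (f x) (f y) = f (chebAux n x y) := by
    intro n x y
    induction n using Nat.strong_induction_on with
    | _ n ih =>
      match n, ih with
      | 0, _ => simp [chebAux]
      | 1, _ => exact (map_ofNat f 3).symm
      | 2, _ => simp [chebAux]
      | m + 3, ih =>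
        simp only [chebAux, map_add, map_sub, map_mul]
        rw [ih (m + 2) (by omega), ih (m + 1) (by omega), ih m (by omega)]
  simp only [T, g, key]

end PowerSums

section Field

variable {K : Type*} [Field K]

theorem sum_mul_eq_cases {v w v' w' : K} (h1 : v' + w' = v + w) (h2 : v' * w' = v * w) :
    (v' = v ∧ w' = w) ∨ (v' = w ∧ w' = v) := by
  have : (v' - v) * (v' - w) = 0 := by linear_combination v' * h1 - h2
  rcases mul_eq_zero.1 this with h | h
  · have := sub_eq_zero.1 h
    subst this
    exact Or.inl ⟨rfl, by linear_combination h1⟩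
  · have := sub_eq_zero.1 h
    subst this
    exact Or.inr ⟨rfl, by linear_combination h1⟩

theorem esymmPair_eq_cases {u v w u' v' w' : K} (h : u * v * w = 1) (h' : u' * v' * w' = 1)
    (he : esymmPair u' v' w' = esymmPair u v w) :
    (u' = u ∧ v' = v ∧ w' = w) ∨ (u' = u ∧ v' = w ∧ w' = v) ∨
    (u' = v ∧ v' = u ∧ w' = w) ∨ (u' = v ∧ v' = w ∧ w' = u) ∨
    (u' = w ∧ v' = u ∧ w' = v) ∨ (u' = w ∧ v' = v ∧ w' = u) := by
  simp only [esymmPair, Prod.mk.injEq] at he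
  obtain ⟨h1, h2⟩ := he
  have : (u' - u) * ((u' - v) * (u' - w)) = 0 := by
    linear_combination u' ^ 2 * h1 - u' * h2 - h + h'
  rcases mul_eq_zero.1 this with h3 | h3
  · have := sub_eq_zero.1 h3
    subst this
    have := sum_mul_eq_cases (v := v) (w := w) (v' := v') (w' := w')
      (by linear_combination h1) (by linear_combination h2 - u' * h1)
    rcases this with h | h
    · exact Or.inl ⟨rfl, h⟩
    · exact Or.inr <| Or.inl ⟨rfl, h⟩
  rcases mul_eq_zero.1 h3 with h3 | h3
  · have := sub_eq_zero.1 h3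
    subst this
    have := sum_mul_eq_cases (v := u) (w := w) (v' := v') (w' := w')
      (by linear_combination h1) (by linear_combination h2 - u' * h1)
    rcases this with h | h
    · exact Or.inr <| Or.inr <| Or.inl ⟨rfl, h⟩
    · exact Or.inr <| Or.inr <| Or.inr <| Or.inl ⟨rfl, h⟩
  · have := sub_eq_zero.1 h3
    subst this
    have := sum_mul_eq_cases (v := u) (w := v) (v' := v') (w' := w')
      (by linear_combination h1) (by linear_combination h2 - u' * h1)
    rcases this with h | h
    · exact Or.inr <| Or.inr <| Or.inr <| Or.inr <| Or.inl ⟨rfl, h⟩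
    · exact Or.inr <| Or.inr <| Or.inr <| Or.inr <| Or.inr ⟨rfl, h⟩

theorem exists_esymmPair_eq [IsAlgClosed K] (p : K × K) :
    ∃ u v w : K, u * v * w = 1 ∧ esymmPair u v w = p := by
  open Polynomial in
  obtain ⟨u, hu⟩ := IsAlgClosed.exists_root (X ^ 3 - C p.1 * X ^ 2 + C p.2 * X - 1 : K[X])
    (by
      have : (X ^ 3 - C p.1 * X ^ 2 + C p.2 * X - 1 : K[X]).degree = 3 := by
        compute_degree!
      rw [this]; decide)
  simp only [Polynomial.IsRoot.def, Polynomial.eval_sub, Polynomial.eval_add, Polynomial.eval_mul,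
    Polynomial.eval_pow, Polynomial.eval_X, Polynomial.eval_C, Polynomial.eval_one] at hu
  have hu0 : u ≠ 0 := by rintro rfl; simp at hu
  open Polynomial in
  obtain ⟨v, hv⟩ := IsAlgClosed.exists_root (X ^ 2 - C (p.1 - u) * X + C u⁻¹ : K[X])
    (by
      have : (X ^ 2 - C (p.1 - u) * X + C u⁻¹ : K[X]).degree = 2 := by
        compute_degree!
      rw [this]; decide)
  simp only [Polynomial.IsRoot.def, Polynomial.eval_sub, Polynomial.eval_add, Polynomial.eval_mul,
    Polynomial.eval_pow, Polynomial.eval_X, Polynomial.eval_C] at hv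
  have hui : u * u⁻¹ = 1 := mul_inv_cancel₀ hu0
  have h1 : u * v * (p.1 - u - v) = 1 := by linear_combination (-u) * hv + hui
  refine ⟨u, v, p.1 - u - v, h1, ?_⟩
  refine Prod.ext (by simp [esymmPair]) ?_
  simp only [esymmPair]
  apply mul_left_cancel₀ hu0
  linear_combination h1 - hu

/-- In an algebraically closed field, the `k`-th powers of the `n`-th roots of unity are the
roots of unity of order dividing `n / gcd k n`. -/
theorem exists_pow_eq_iff [IsAlgClosed K] {k n : ℕ} (hk : 0 < k) (x : K) :
    (∃ y : K, y ^ n = 1 ∧ y ^ k = x) ↔ x ^ (n / k.gcd n) = 1 := by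
  have hd : 0 < k.gcd n := Nat.gcd_pos_of_pos_left n hk
  obtain ⟨k', hk'⟩ := Nat.gcd_dvd_left k n
  obtain ⟨m, hm⟩ := Nat.gcd_dvd_right k n
  have hm' : n / k.gcd n = m := Nat.div_eq_of_eq_mul_right hd hm
  rw [hm']
  constructor
  · rintro ⟨y, hy, rfl⟩
    rw [← pow_mul, show k * m = n * k' by
      calc k * m = (k.gcd n * k') * m := by rw [← hk']
        _ = (k.gcd n * m) * k' := by ring
        _ = n * k' := by rw [← hm], pow_mul, hy, one_pow]
  · intro hx
    obtain ⟨z, hz⟩ := IsAlgClosed.exists_pow_nat_eq x hd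
    by_cases hm0 : m = 0
    · have hn : n = 0 := by rw [hm, hm0, mul_zero]
      subst hn
      exact ⟨z, by simp, by simpa using hz⟩
    have hzn : z ^ n = 1 := by
      rw [hm, pow_mul, hz, hx]
    have hz0 : z ≠ 0 := by
      rintro rfl
      rw [zero_pow hd.ne'] at hz
      rw [← hz, zero_pow hm0] at hx
      exact zero_ne_one hx
    refine ⟨z ^ (k.gcdA n), ?_, ?_⟩
    · rw [← zpow_natCast, ← zpow_mul, mul_comm, zpow_mul, zpow_natCast, hzn, one_zpow]
    · have e := Nat.gcd_eq_gcd_ab k n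
      rw [← zpow_natCast, ← zpow_mul, show k.gcdA n * (k : ℤ) =
        (k.gcd n : ℤ) + (n : ℤ) * (-k.gcdB n) by rw [e]; ring, zpow_add₀ hz0, zpow_natCast, hz,
        zpow_mul, zpow_natCast, hzn, one_zpow, mul_one]

open Polynomial in
theorem card_nthRootsFinset_one [IsAlgClosed K] {n : ℕ} (hn : (n : K) ≠ 0) :
    (nthRootsFinset n (1 : K)).card = n := by
  have : NeZero (n : K) := ⟨hn⟩
  obtain ⟨ζ, hζ⟩ := HasEnoughRootsOfUnity.exists_primitiveRoot K n
  exact hζ.card_nthRootsFinset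

open Polynomial in
theorem exists_algebraMap_eq_of_pow_card_eq {F : Type*} [Field F] [Fintype F] [Algebra F K]
    {x : K} (hx : x ^ Fintype.card F = x) : ∃ y : F, algebraMap F K y = x := by
  have h1 : (X ^ Fintype.card F - X : F[X]).natDegree = Fintype.card F :=
    FiniteField.X_pow_card_sub_X_natDegree_eq F Fintype.one_lt_card
  have h2 := prod_multiset_X_sub_C_of_monic_of_roots_card_eq
    (p := (X ^ Fintype.card F - X : F[X]))
    (by
      have := monic_X_pow_sub (p := (X : F[X])) (n := Fintype.card F)
        (by rw [degree_X]; exact_mod_cast Fintype.one_lt_card (α := F))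
      exact this)
    (by rw [h1, FiniteField.roots_X_pow_card_sub_X]; rfl)
  rw [FiniteField.roots_X_pow_card_sub_X] at h2
  have h3 := congrArg (aeval x) h2
  change aeval x (∏ a : F, (X - C a)) = _ at h3
  simp only [map_prod, map_sub, aeval_X, aeval_C, map_pow, hx, sub_self] at h3
  obtain ⟨y, -, hy⟩ := Finset.prod_eq_zero_iff.1 h3
  exact ⟨y, (sub_eq_zero.1 hy).symm⟩

open Finset in
theorem mul_card_image_of_card_fiber {α β : Type*} [DecidableEq β] {s : Finset α} {f : α → β}
    {n : ℕ} (h : ∀ x ∈ s, #{y ∈ s | f y = f x} = n) : n * #(s.image f) = #s := by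
  rw [card_eq_sum_card_image f s, sum_const_nat (m := n), mul_comm]
  intro y hy
  obtain ⟨x, hx, rfl⟩ := mem_image.1 hy
  exact h x hx

/-- The first two elementary symmetric functions of `u`, `v` and `(u v)⁻¹`. -/
def unitEsymmPair (u v : K) : K × K := esymmPair u v (u * v)⁻¹

theorem unitEsymmPair_eq_esymmPair {u v w : K} (h : u * v * w = 1) :
    unitEsymmPair u v = esymmPair u v w := by
  rw [unitEsymmPair, eq_inv_of_mul_eq_one_right h]

theorem unitEsymmPair_eq_cases {u v w u' v' : K} (h : u * v * w = 1) (h' : u' * v' ≠ 0)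
    (he : unitEsymmPair u' v' = unitEsymmPair u v) :
    (u' = u ∧ v' = v) ∨ (u' = u ∧ v' = w) ∨ (u' = v ∧ v' = u) ∨ (u' = v ∧ v' = w) ∨
    (u' = w ∧ v' = u) ∨ (u' = w ∧ v' = v) := by
  rw [unitEsymmPair_eq_esymmPair h] at he
  have := esymmPair_eq_cases h (mul_inv_cancel₀ h') he
  tauto

theorem esymmPair_rotate (u v w : K) : esymmPair v w u = esymmPair u v w :=
  Prod.ext (by simp only [esymmPair]; ring) (by simp only [esymmPair]; ring)

theorem esymmPair_swap (u v w : K) : esymmPair v u w = esymmPair u v w :=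
  Prod.ext (by simp only [esymmPair]; ring) (by simp only [esymmPair]; ring)

theorem unitEsymmPair_rotate {u v w : K} (h : u * v * w = 1) :
    unitEsymmPair v w = unitEsymmPair u v := by
  rw [unitEsymmPair_eq_esymmPair h, unitEsymmPair_eq_esymmPair (w := u) (by linear_combination h),
    esymmPair_rotate]

theorem unitEsymmPair_swap (u v : K) : unitEsymmPair v u = unitEsymmPair u v := by
  rw [unitEsymmPair, mul_comm v u, esymmPair_swap, unitEsymmPair]

open Finset Polynomial

theorem eq_or_eq_or_eq_of_unitEsymmPair_eq {u v w u' v' : K} (h : u * v * w = 1)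
    (h' : u' * v' ≠ 0) (he : unitEsymmPair u' v' = unitEsymmPair u v) :
    u' = u ∨ u' = v ∨ u' = w := by
  have := unitEsymmPair_eq_cases h h' he
  tauto

theorem ne_zero_of_pow_eq_one_of_pos {n : ℕ} (hn : 0 < n) {u : K} (h : u ^ n = 1) : u ≠ 0 := by
  rintro rfl
  simp [hn.ne'] at h

theorem pow_mul_self_eq_self {q n : ℕ} (hq : 0 < q) (hn : n ∣ q ^ 2 - 1) {u : K}
    (hu : u ^ n = 1) : (u ^ q) ^ q = u := by
  have h1 : u ^ (q ^ 2 - 1) = 1 := by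
    obtain ⟨m, hm⟩ := hn
    rw [hm, pow_mul, hu, one_pow]
  have h2 : q * q = (q ^ 2 - 1) + 1 := by
    have : 0 < q ^ 2 := by positivity
    rw [← pow_two]
    omega
  rw [← pow_mul, h2, pow_succ, h1, one_mul]

theorem mul_pow_mul_pow_eq_one {q n : ℕ} (hn : n ∣ q ^ 2 + q + 1) {u : K}
    (hu : u ^ n = 1) : u * u ^ q * (u ^ q) ^ q = 1 := by
  obtain ⟨m, hm⟩ := hn
  rw [← pow_mul, ← pow_succ', ← pow_add, show q + 1 + q * q = q ^ 2 + q + 1 by ring, hm, pow_mul,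
    hu, one_pow]

variable [DecidableEq K]

/-- Ordered pairs of `a`-th roots of unity which together with the inverse of their product form
three distinct elements. -/
noncomputable def distinctPairs (K : Type*) [Field K] [DecidableEq K] (a : ℕ) : Finset (K × K) :=
  {p ∈ nthRootsFinset a (1 : K) ×ˢ nthRootsFinset a (1 : K) |
    p.1 ≠ p.2 ∧ p.1 * (p.1 * p.2) ≠ 1 ∧ p.2 * (p.1 * p.2) ≠ 1}

theorem mem_distinctPairs {a : ℕ} (ha : 0 < a) {u v w : K} (h : u * v * w = 1) :
    (u, v) ∈ distinctPairs K a ↔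
      (u ^ a = 1 ∧ v ^ a = 1 ∧ w ^ a = 1) ∧ u ≠ v ∧ u ≠ w ∧ v ≠ w := by
  have huv : u * v ≠ 0 := left_ne_zero_of_mul_eq_one h
  have e1 : u * (u * v) = 1 ↔ u = w := by
    rw [← h, mul_comm u, mul_right_inj' huv]
  have e2 : v * (u * v) = 1 ↔ v = w := by
    rw [← h, mul_comm v, mul_right_inj' huv]
  have e3 : u ^ a = 1 → v ^ a = 1 → w ^ a = 1 := by
    intro h1 h2
    have := congrArg (· ^ a) h
    simpa [mul_pow, h1, h2] using this
  simp only [distinctPairs, mem_filter, mem_product, mem_nthRootsFinset ha, ne_eq, e1, e2]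
  tauto

theorem card_distinctPairs [IsAlgClosed K] {a : ℕ} (ha : (a : K) ≠ 0) :
    #(distinctPairs K a) + 3 * a = a ^ 2 + 2 * Nat.gcd 3 a := by
  have ha0 : 0 < a := Nat.pos_of_ne_zero (by rintro rfl; simp at ha)
  have ht0 : 0 < Nat.gcd 3 a := Nat.gcd_pos_of_pos_right 3 ha0
  have ht : ((Nat.gcd 3 a : ℕ) : K) ≠ 0 := by
    obtain ⟨m, hm⟩ := Nat.gcd_dvd_right 3 a
    intro h
    apply ha
    rw [hm, Nat.cast_mul, h, zero_mul]
  set W := nthRootsFinset a (1 : K) with hW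
  set S1 : Finset (K × K) := W.image (fun u => (u, u)) with hS1
  set S2 : Finset (K × K) := W.image (fun u => (u, (u * u)⁻¹)) with hS2
  set S3 : Finset (K × K) := W.image (fun u => ((u * u)⁻¹, u)) with hS3
  set S0 : Finset (K × K) := (nthRootsFinset (Nat.gcd 3 a) (1 : K)).image (fun u => (u, u)) with hS0
  have hcW : #W = a := card_nthRootsFinset_one ha
  have c1 : #S1 = a := by
    rw [hS1, card_image_of_injective _ (fun x y h => (Prod.ext_iff.1 h).1), hcW]
  have c2 : #S2 = a := by
    rw [hS2, card_image_of_injective _ (fun x y h => (Prod.ext_iff.1 h).1), hcW]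
  have c3 : #S3 = a := by
    rw [hS3, card_image_of_injective _ (fun x y h => (Prod.ext_iff.1 h).2), hcW]
  have c0 : #S0 = Nat.gcd 3 a := by
    rw [hS0, card_image_of_injective _ (fun x y h => (Prod.ext_iff.1 h).1),
      card_nthRootsFinset_one ht]
  have mem0 {u v : K} (hu : u ∈ W) : u ≠ 0 := by
    rintro rfl
    simp [hW, mem_nthRootsFinset ha0, ha0.ne'] at hu
  have memW {u : K} : u ∈ W ↔ u ^ a = 1 := mem_nthRootsFinset ha0 1
  have m0 (u v : K) : (u, v) ∈ S0 ↔ u ∈ W ∧ u = v ∧ u * u * u = 1 := by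
    simp only [hS0, mem_image, mem_nthRootsFinset ht0, pow_gcd_eq_one, Prod.mk.injEq, memW]
    constructor
    · rintro ⟨x, ⟨h3, h4⟩, rfl, rfl⟩
      exact ⟨h4, rfl, by rw [← h3]; ring⟩
    · rintro ⟨h1, rfl, h2⟩
      exact ⟨u, ⟨by rw [← h2]; ring, h1⟩, rfl, rfl⟩
  have m1 (u v : K) : (u, v) ∈ S1 ↔ u ∈ W ∧ v ∈ W ∧ u = v := by
    simp only [hS1, mem_image, Prod.mk.injEq]
    constructor
    · rintro ⟨x, h, rfl, rfl⟩
      exact ⟨h, h, rfl⟩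
    · rintro ⟨h, -, rfl⟩
      exact ⟨u, h, rfl, rfl⟩
  have m2 (u v : K) : (u, v) ∈ S2 ↔ u ∈ W ∧ v ∈ W ∧ u * (u * v) = 1 := by
    simp only [hS2, mem_image, Prod.mk.injEq]
    constructor
    · rintro ⟨x, h, rfl, rfl⟩
      refine ⟨h, ?_, ?_⟩
      · rw [memW] at h ⊢
        rw [inv_pow, mul_pow, h]; simp
      · have := mem0 (v := 0) h
        field_simp
    · rintro ⟨h, -, h'⟩
      exact ⟨u, h, rfl, (eq_inv_of_mul_eq_one_right (by rw [← h']; ring)).symm⟩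
  have m3 (u v : K) : (u, v) ∈ S3 ↔ u ∈ W ∧ v ∈ W ∧ v * (u * v) = 1 := by
    have : (u, v) ∈ S3 ↔ (v, u) ∈ S2 := by
      simp only [hS2, hS3, mem_image, Prod.mk.injEq, and_comm]
    rw [this, m2, mul_comm v u]
    tauto
  have i12 : S1 ∩ S2 = S0 := by
    ext ⟨u, v⟩
    rw [mem_inter, m1, m2, m0]
    constructor
    · rintro ⟨⟨h1, -, rfl⟩, -, -, h⟩
      exact ⟨h1, rfl, by rw [← h]; ring⟩
    · rintro ⟨h1, rfl, h⟩
      exact ⟨⟨h1, h1, rfl⟩, h1, h1, by rw [← h]; ring⟩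
  have i3 : (S1 ∪ S2) ∩ S3 = S0 := by
    ext ⟨u, v⟩
    rw [mem_inter, mem_union, m1, m2, m3, m0]
    constructor
    · rintro ⟨⟨h1, -, rfl⟩ | ⟨h1, -, h2⟩, -, -, h⟩
      · exact ⟨h1, rfl, by rw [← h]; ring⟩
      · have huv : u = v := by
          have : u * v ≠ 0 := right_ne_zero_of_mul_eq_one h2
          apply mul_right_cancel₀ this
          rw [h2, h]
        subst huv
        exact ⟨h1, rfl, by rw [← h]; ring⟩
    · rintro ⟨h1, rfl, h⟩
      exact ⟨Or.inl ⟨h1, h1, rfl⟩, h1, h1, by rw [← h]; ring⟩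
  have hcompl : distinctPairs K a = (W ×ˢ W) \ (S1 ∪ S2 ∪ S3) := by
    ext ⟨u, v⟩
    simp only [distinctPairs, mem_filter, mem_sdiff, mem_union, m1, m2, m3, mem_product, ← hW]
    tauto
  have hsub : S1 ∪ S2 ∪ S3 ⊆ W ×ˢ W := by
    rintro ⟨u, v⟩
    simp only [mem_union, m1, m2, m3, mem_product]
    tauto
  have k0 := card_sdiff_add_card_eq_card hsub
  rw [← hcompl, card_product, hcW] at k0
  have k1 := card_union_add_card_inter S1 S2
  have k2 := card_union_add_card_inter (S1 ∪ S2) S3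
  rw [i12] at k1
  rw [i3] at k2
  rw [pow_two]
  omega

theorem six_mul_card_image_distinctPairs {a : ℕ} (ha : 0 < a) :
    6 * #((distinctPairs K a).image fun p => unitEsymmPair p.1 p.2) = #(distinctPairs K a) := by
  apply mul_card_image_of_card_fiber
  rintro ⟨u, v⟩ huv
  have huv0 : u * v ≠ 0 := by
    intro h
    simp only [distinctPairs, mem_filter, mem_product, mem_nthRootsFinset ha] at huv
    have := congrArg (· ^ a) h
    simp [mul_pow, huv.1.1, huv.1.2, ha.ne'] at this
  obtain ⟨w, h⟩ : ∃ w, u * v * w = 1 := ⟨_, mul_inv_cancel₀ huv0⟩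
  obtain ⟨⟨hu, hv, hw⟩, h1, h2, h3⟩ := (mem_distinctPairs ha h).1 huv
  have : {y ∈ distinctPairs K a | unitEsymmPair y.1 y.2 = unitEsymmPair u v} =
      {(u, v), (u, w), (v, u), (v, w), (w, u), (w, v)} := by
    ext ⟨u', v'⟩
    simp only [mem_filter, mem_insert, mem_singleton, Prod.mk.injEq]
    constructor
    · rintro ⟨hd, he⟩
      refine unitEsymmPair_eq_cases h ?_ he
      intro h'
      simp only [distinctPairs, mem_filter, h'] at hd
      have := hd.1
      simp only [mem_product, mem_nthRootsFinset ha] at this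
      have := congrArg (· ^ a) h'
      simp_all [mul_pow, ha.ne']
    · have r1 : unitEsymmPair v w = unitEsymmPair u v := unitEsymmPair_rotate h
      have r2 : unitEsymmPair w u = unitEsymmPair u v := by
        rw [unitEsymmPair_rotate (u := v) (by linear_combination h), r1]
      rintro (⟨rfl, rfl⟩ | ⟨rfl, rfl⟩ | ⟨rfl, rfl⟩ | ⟨rfl, rfl⟩ | ⟨rfl, rfl⟩ | ⟨rfl, rfl⟩)
      · exact ⟨huv, rfl⟩
      · exact ⟨(mem_distinctPairs ha (w := v) (by linear_combination h)).2
          ⟨⟨hu, hw, hv⟩, h2, h1, h3.symm⟩, by rw [unitEsymmPair_swap, r2]⟩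
      · exact ⟨(mem_distinctPairs ha (w := w) (by linear_combination h)).2
          ⟨⟨hv, hu, hw⟩, h1.symm, h3, h2⟩, by rw [unitEsymmPair_swap]⟩
      · exact ⟨(mem_distinctPairs ha (w := u) (by linear_combination h)).2
          ⟨⟨hv, hw, hu⟩, h3, h1.symm, h2.symm⟩, r1⟩
      · exact ⟨(mem_distinctPairs ha (w := v) (by linear_combination h)).2
          ⟨⟨hw, hu, hv⟩, h2.symm, h3.symm, h1⟩, r2⟩
      · exact ⟨(mem_distinctPairs ha (w := u) (by linear_combination h)).2
          ⟨⟨hw, hv, hu⟩, h3.symm, h2.symm, h1.symm⟩, by rw [unitEsymmPair_swap, r1]⟩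
  rw [this]
  simp [card_insert_of_notMem, h1, h2, h3, h1.symm, h2.symm, h3.symm]

/-- The `n`-th roots of unity which are not fixed by `u ↦ u ^ q`. -/
noncomputable def nonfixedRoots (K : Type*) [Field K] [DecidableEq K] (q n : ℕ) : Finset K :=
  {u ∈ nthRootsFinset n (1 : K) | u ^ q ≠ u}

/-- The `n`-th roots of unity which are fixed by `u ↦ u ^ q`. -/
noncomputable def fixedRoots (K : Type*) [Field K] [DecidableEq K] (q n : ℕ) : Finset K :=
  {u ∈ nthRootsFinset n (1 : K) | u ^ q = u}

theorem mem_nonfixedRoots {q n : ℕ} (hn : 0 < n) {u : K} :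
    u ∈ nonfixedRoots K q n ↔ u ^ n = 1 ∧ u ^ q ≠ u := by
  rw [nonfixedRoots, mem_filter, mem_nthRootsFinset hn]

theorem mem_fixedRoots {q n : ℕ} (hn : 0 < n) {u : K} :
    u ∈ fixedRoots K q n ↔ u ^ n = 1 ∧ u ^ q = u := by
  rw [fixedRoots, mem_filter, mem_nthRootsFinset hn]

theorem nthRootsFinset_eq_union (K : Type*) [Field K] [DecidableEq K] (q n : ℕ) :
    nthRootsFinset n (1 : K) = nonfixedRoots K q n ∪ fixedRoots K q n := by
  rw [union_comm]
  exact (filter_union_filter_not_eq _ _).symm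

theorem card_fixedRoots [IsAlgClosed K] {q n : ℕ} (hq : 0 < q) (hn : (n : K) ≠ 0) :
    #(fixedRoots K q n) = n.gcd (q - 1) := by
  have hn0 : 0 < n := Nat.pos_of_ne_zero (by rintro rfl; simp at hn)
  have ht0 : 0 < n.gcd (q - 1) := Nat.gcd_pos_of_pos_left _ hn0
  have ht : ((n.gcd (q - 1) : ℕ) : K) ≠ 0 := by
    obtain ⟨m, hm⟩ := Nat.gcd_dvd_left n (q - 1)
    intro h
    apply hn
    rw [hm, Nat.cast_mul, h, zero_mul]
  rw [← card_nthRootsFinset_one ht]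
  congr 1
  ext u
  rw [mem_fixedRoots hn0, mem_nthRootsFinset ht0, pow_gcd_eq_one]
  refine and_congr_right fun h => ?_
  have hu := ne_zero_of_pow_eq_one_of_pos hn0 h
  obtain ⟨r, rfl⟩ : ∃ r, q = r + 1 := ⟨q - 1, by omega⟩
  rw [Nat.add_sub_cancel, pow_succ]
  exact mul_eq_right₀ hu

theorem card_nonfixedRoots [IsAlgClosed K] {q n : ℕ} (hq : 0 < q) (hn : (n : K) ≠ 0) :
    #(nonfixedRoots K q n) + n.gcd (q - 1) = n := by
  rw [← card_fixedRoots hq hn, add_comm]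
  refine (card_filter_add_card_filter_not _).trans (card_nthRootsFinset_one hn)

/-- The point with coordinates the elementary symmetric functions of `u`, `u ^ q` and the inverse
of their product. -/
def frobEsymmPair (q : ℕ) (u : K) : K × K := unitEsymmPair u (u ^ q)

theorem card_image_fixedRoots {q n : ℕ} (hn : 0 < n) :
    #((fixedRoots K q n).image (frobEsymmPair q)) = #(fixedRoots K q n) := by
  apply card_image_of_injOn
  intro u hu u' hu' he
  rw [mem_coe, mem_fixedRoots hn] at hu hu'
  have h0 := ne_zero_of_pow_eq_one_of_pos hn hu.1
  have h0' := ne_zero_of_pow_eq_one_of_pos hn hu'.1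
  simp only [frobEsymmPair, hu.2, hu'.2] at he
  have := unitEsymmPair_eq_cases (mul_inv_cancel₀ (mul_ne_zero h0' h0')) (mul_ne_zero h0 h0) he
  rcases this with h | h | h | h | h | h
  all_goals first | exact h.1 | exact h.2

theorem two_mul_card_image_nonfixedRoots {q n : ℕ} (hq : 0 < q) (hn0 : 0 < n)
    (hn : n ∣ q ^ 2 - 1) :
    2 * #((nonfixedRoots K q n).image (frobEsymmPair q)) = #(nonfixedRoots K q n) := by
  apply mul_card_image_of_card_fiber
  intro u hu
  rw [mem_nonfixedRoots hn0] at hu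
  have hu0 := ne_zero_of_pow_eq_one_of_pos hn0 hu.1
  have hqq := pow_mul_self_eq_self hq hn hu.1
  have : {y ∈ nonfixedRoots K q n | frobEsymmPair q y = frobEsymmPair q u} = {u, u ^ q} := by
    ext u'
    simp only [mem_filter, mem_nonfixedRoots hn0, mem_insert, mem_singleton]
    constructor
    · rintro ⟨⟨h1, h2⟩, he⟩
      have hu0' := ne_zero_of_pow_eq_one_of_pos hn0 h1
      rcases eq_or_eq_or_eq_of_unitEsymmPair_eq
        (mul_inv_cancel₀ (mul_ne_zero hu0 (pow_ne_zero q hu0)))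
        (mul_ne_zero hu0' (pow_ne_zero q hu0')) he with h | h | h
      · exact Or.inl h
      · exact Or.inr h
      · exact absurd (by rw [h, inv_pow, mul_pow, hqq, mul_comm]) h2
    · rintro (rfl | rfl)
      · exact ⟨hu, rfl⟩
      · refine ⟨⟨by rw [← pow_mul, mul_comm, pow_mul, hu.1, one_pow], ?_⟩, ?_⟩
        · rw [hqq]; exact hu.2.symm
        · rw [frobEsymmPair, frobEsymmPair, hqq, unitEsymmPair_swap]
  rw [this, card_pair hu.2.symm]

theorem three_mul_card_image_nonfixedRoots {q n : ℕ} (hinj : Function.Injective fun x : K => x ^ q)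
    (hn0 : 0 < n) (hn : n ∣ q ^ 2 + q + 1) :
    3 * #((nonfixedRoots K q n).image (frobEsymmPair q)) = #(nonfixedRoots K q n) := by
  apply mul_card_image_of_card_fiber
  intro u hu
  rw [mem_nonfixedRoots hn0] at hu
  have hpow {x : K} (hx : x ^ n = 1) : (x ^ q) ^ n = 1 := by
    rw [← pow_mul, mul_comm, pow_mul, hx, one_pow]
  have hne {x : K} (hx : x ^ q ≠ x) : (x ^ q) ^ q ≠ x ^ q := fun h => hx (hinj h)
  have hN := mul_pow_mul_pow_eq_one hn hu.1
  have hN' := mul_pow_mul_pow_eq_one hn (hpow hu.1)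
  have hqqq : ((u ^ q) ^ q) ^ q = u := by
    have h0 : u ^ q * (u ^ q) ^ q ≠ 0 := left_ne_zero_of_mul_eq_one hN'
    apply mul_left_cancel₀ h0
    rw [hN', ← hN]
    ring
  have hr : frobEsymmPair q (u ^ q) = frobEsymmPair q u := unitEsymmPair_rotate hN
  have hr' : frobEsymmPair q ((u ^ q) ^ q) = frobEsymmPair q (u ^ q) := unitEsymmPair_rotate hN'
  have : {y ∈ nonfixedRoots K q n | frobEsymmPair q y = frobEsymmPair q u} =
      {u, u ^ q, (u ^ q) ^ q} := by
    ext u'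
    simp only [mem_filter, mem_nonfixedRoots hn0, mem_insert, mem_singleton]
    constructor
    · rintro ⟨⟨h1, h2⟩, he⟩
      have hu0' := ne_zero_of_pow_eq_one_of_pos hn0 h1
      exact eq_or_eq_or_eq_of_unitEsymmPair_eq hN (mul_ne_zero hu0' (pow_ne_zero q hu0')) he
    · rintro (rfl | rfl | rfl)
      · exact ⟨hu, rfl⟩
      · exact ⟨⟨hpow hu.1, hne hu.2⟩, hr⟩
      · exact ⟨⟨hpow (hpow hu.1), hne (hne hu.2)⟩, hr'.trans hr⟩
  rw [this]
  have h3 : u ≠ (u ^ q) ^ q := by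
    intro h
    apply hu.2
    nth_rewrite 2 [← hqqq]
    rw [← h]
  simp [card_insert_of_notMem, hu.2.symm, (hne hu.2).symm, h3]

/-- The points whose roots are `a`-th roots of unity, or powers under `u ↦ u ^ q` of a `b`-th or a
`c`-th root of unity. -/
noncomputable def rootPoints (K : Type*) [Field K] [DecidableEq K] (q a b c : ℕ) :
    Finset (K × K) :=
  ((nthRootsFinset a (1 : K) ×ˢ nthRootsFinset a (1 : K)).image fun p => unitEsymmPair p.1 p.2) ∪
    (nthRootsFinset b (1 : K)).image (frobEsymmPair q) ∪
    (nthRootsFinset c (1 : K)).image (frobEsymmPair q)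

theorem rootPoints_eq {q a b c : ℕ} (ha0 : 0 < a) (hb0 : 0 < b) (hc0 : 0 < c)
    (hab : a ∣ b) (haq : ∀ u : K, u ^ a = 1 → u ^ q = u)
    (hcb : ∀ u : K, u ^ c = 1 → u ^ q = u → u ^ b = 1) :
    rootPoints K q a b c =
      ((distinctPairs K a).image fun p => unitEsymmPair p.1 p.2) ∪
      ((nonfixedRoots K q b).image (frobEsymmPair q) ∪
      ((nonfixedRoots K q c).image (frobEsymmPair q) ∪
      (fixedRoots K q b).image (frobEsymmPair q))) := by
  have union_aux (A B C P F G : Finset (K × K)) (h1 : A ⊆ P) (h2 : P ⊆ A ∪ F) (h3 : G ⊆ F) :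
      P ∪ (B ∪ F) ∪ (C ∪ G) = A ∪ (B ∪ (C ∪ F)) := by
    ext p
    have h1 := @h1 p
    have h2 := @h2 p
    have h3 := @h3 p
    simp only [mem_union] at h1 h2 h3 ⊢
    tauto
  have hab' {u : K} (h : u ^ a = 1) : u ^ b = 1 := by
    obtain ⟨m, rfl⟩ := hab
    rw [pow_mul, h, one_pow]
  have hfc : fixedRoots K q c ⊆ fixedRoots K q b := by
    intro u
    rw [mem_fixedRoots hc0, mem_fixedRoots hb0]
    exact fun h => ⟨hcb u h.1 h.2, h.2⟩
  have hdist : (distinctPairs K a).image (fun p => unitEsymmPair p.1 p.2) ⊆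
      (nthRootsFinset a (1 : K) ×ˢ nthRootsFinset a (1 : K)).image
        fun p => unitEsymmPair p.1 p.2 := image_subset_image (filter_subset _ _)
  have hpairs : (nthRootsFinset a (1 : K) ×ˢ nthRootsFinset a (1 : K)).image
        (fun p => unitEsymmPair p.1 p.2) ⊆
      (distinctPairs K a).image (fun p => unitEsymmPair p.1 p.2) ∪
        (fixedRoots K q b).image (frobEsymmPair q) := by
    intro p hp
    obtain ⟨⟨u, v⟩, huv, rfl⟩ := mem_image.1 hp
    rw [mem_product, mem_nthRootsFinset ha0, mem_nthRootsFinset ha0] at huv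
    obtain ⟨hu, hv⟩ := huv
    have h0 : u * v ≠ 0 :=
      mul_ne_zero (ne_zero_of_pow_eq_one_of_pos ha0 hu) (ne_zero_of_pow_eq_one_of_pos ha0 hv)
    obtain ⟨w, h⟩ : ∃ w, u * v * w = 1 := ⟨_, mul_inv_cancel₀ h0⟩
    have hw : w ^ a = 1 := by
      have := congrArg (· ^ a) h
      simpa [mul_pow, hu, hv] using this
    have hfix {x : K} (hx : x ^ a = 1) :
        unitEsymmPair x x ∈ (fixedRoots K q b).image (frobEsymmPair q) := by
      refine mem_image.2 ⟨x, (mem_fixedRoots hb0).2 ⟨hab' hx, haq x hx⟩, ?_⟩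
      rw [frobEsymmPair, haq x hx]
    have r1 : unitEsymmPair v w = unitEsymmPair u v := unitEsymmPair_rotate h
    have r2 : unitEsymmPair w u = unitEsymmPair u v := by
      rw [unitEsymmPair_rotate (u := v) (by linear_combination h), r1]
    by_cases h1 : u = v
    · subst h1; exact mem_union_right _ (hfix hu)
    by_cases h2 : u = w
    · subst h2
      exact mem_union_right _ (by simpa only [← r2] using hfix hu)
    by_cases h3 : v = w
    · subst h3
      exact mem_union_right _ (by simpa only [← r1] using hfix hv)
    exact mem_union_left _ (mem_image.2 ⟨(u, v),
      (mem_distinctPairs ha0 h).2 ⟨⟨hu, hv, hw⟩, h1, h2, h3⟩, rfl⟩)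
  have hfc' := image_subset_image (f := frobEsymmPair q) hfc
  rw [rootPoints, nthRootsFinset_eq_union K q b, nthRootsFinset_eq_union K q c, image_union,
    image_union]
  exact union_aux _ _ _ _ _ _ hdist hpairs hfc'

theorem card_rootPoints [IsAlgClosed K] {q a b c : ℕ} (hq : 0 < q)
    (hinj : Function.Injective fun x : K => x ^ q)
    (ha : (a : K) ≠ 0) (hb : (b : K) ≠ 0) (hc : (c : K) ≠ 0)
    (hab : a ∣ b) (haq : a ∣ q - 1) (hbq : b ∣ q ^ 2 - 1) (hcq : c ∣ q ^ 2 + q + 1)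
    (hcb : c.gcd (q - 1) ∣ b) :
    (#(rootPoints K q a b c) : ℚ) = (a : ℚ) ^ 2 / 6 + (b : ℚ) / 2 + (c : ℚ) / 3 +
      (((b.gcd (q - 1) : ℕ) - (a : ℚ)) / 2 +
        ((Nat.gcd 3 a : ℕ) - ((c.gcd (q - 1) : ℕ) : ℚ)) / 3) := by
  have pos {n : ℕ} (hn : (n : K) ≠ 0) : 0 < n := Nat.pos_of_ne_zero (by rintro rfl; simp at hn)
  have ha0 := pos ha
  have hb0 := pos hb
  have hc0 := pos hc
  have hfix (u : K) (hu : u ^ a = 1) : u ^ q = u := by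
    obtain ⟨m, hm⟩ := haq
    obtain ⟨r, rfl⟩ : ∃ r, q = r + 1 := ⟨q - 1, by omega⟩
    rw [Nat.add_sub_cancel] at hm
    rw [pow_succ, hm, pow_mul, hu, one_pow, one_mul]
  have hcb' (u : K) (hu : u ^ c = 1) (hu' : u ^ q = u) : u ^ b = 1 := by
    have h0 := ne_zero_of_pow_eq_one_of_pos hc0 hu
    rw [← Nat.sub_add_cancel hq, pow_succ, mul_eq_right₀ h0] at hu'
    obtain ⟨m, hm⟩ := hcb
    rw [hm, pow_mul, pow_gcd_eq_one.2 ⟨hu, hu'⟩, one_pow]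
  rw [rootPoints_eq ha0 hb0 hc0 hab hfix hcb']
  have hdist {u v : K} (huv : (u, v) ∈ distinctPairs K a) :
      ∃ w, u * v * w = 1 ∧ (u ^ q = u ∧ v ^ q = v ∧ w ^ q = w) ∧ u ≠ v ∧ u ≠ w ∧ v ≠ w := by
    have h0 : u * v ≠ 0 := by
      have h := huv
      simp only [distinctPairs, mem_filter, mem_product, mem_nthRootsFinset ha0] at h
      exact mul_ne_zero (ne_zero_of_pow_eq_one_of_pos ha0 h.1.1) (ne_zero_of_pow_eq_one_of_pos ha0 h.1.2)
    have h := mul_inv_cancel₀ h0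
    obtain ⟨⟨h1, h2, h3⟩, h4⟩ := (mem_distinctPairs ha0 h).1 huv
    exact ⟨_, h, ⟨hfix _ h1, hfix _ h2, hfix _ h3⟩, h4⟩
  have hself {n : ℕ} (hn : 0 < n) {u : K} (hu : u ^ n = 1) : u * u ^ q ≠ 0 :=
    mul_ne_zero (ne_zero_of_pow_eq_one_of_pos hn hu) (pow_ne_zero _ (ne_zero_of_pow_eq_one_of_pos hn hu))
  have d1 {n : ℕ} (hn : 0 < n) : Disjoint
      ((distinctPairs K a).image fun p => unitEsymmPair p.1 p.2)
      ((nonfixedRoots K q n).image (frobEsymmPair q)) := by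
    rw [disjoint_left]
    intro p hp hp'
    obtain ⟨⟨u, v⟩, huv, rfl⟩ := mem_image.1 hp
    obtain ⟨u', hu', he⟩ := mem_image.1 hp'
    rw [mem_nonfixedRoots hn] at hu'
    obtain ⟨w, h, ⟨h1, h2, h3⟩, -⟩ := hdist huv
    rcases eq_or_eq_or_eq_of_unitEsymmPair_eq h (hself hn hu'.1) he with e | e | e <;>
      exact hu'.2 (by rwa [e])
  have d2 : Disjoint ((distinctPairs K a).image fun p => unitEsymmPair p.1 p.2)
      ((fixedRoots K q b).image (frobEsymmPair q)) := by
    rw [disjoint_left]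
    intro p hp hp'
    obtain ⟨⟨u, v⟩, huv, rfl⟩ := mem_image.1 hp
    obtain ⟨u', hu', he⟩ := mem_image.1 hp'
    rw [mem_fixedRoots hb0] at hu'
    obtain ⟨w, h, -, h1, h2, h3⟩ := hdist huv
    have h0 := hself hb0 hu'.1
    rw [frobEsymmPair, hu'.2] at he
    rw [hu'.2] at h0
    rcases unitEsymmPair_eq_cases h h0 he with e | e | e | e | e | e
    · exact h1 (e.1.symm.trans e.2)
    · exact h2 (e.1.symm.trans e.2)
    · exact h1 (e.2.symm.trans e.1)
    · exact h3 (e.1.symm.trans e.2)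
    · exact h2 (e.2.symm.trans e.1)
    · exact h3 (e.2.symm.trans e.1)
  have d3 {n : ℕ} (hn : 0 < n) : Disjoint
      ((nonfixedRoots K q n).image (frobEsymmPair q))
      ((fixedRoots K q b).image (frobEsymmPair q)) := by
    rw [disjoint_left]
    intro p hp hp'
    obtain ⟨u, hu, rfl⟩ := mem_image.1 hp
    obtain ⟨u', hu', he⟩ := mem_image.1 hp'
    rw [mem_fixedRoots hb0] at hu'
    rw [mem_nonfixedRoots hn] at hu
    rcases eq_or_eq_or_eq_of_unitEsymmPair_eq (mul_inv_cancel₀ (hself hb0 hu'.1))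
      (hself hn hu.1) he.symm with e | e | e
    · exact hu.2 (by rw [e, hu'.2])
    · exact hu.2 (by rw [e, hu'.2, hu'.2])
    · exact hu.2 (by rw [e, inv_pow, mul_pow, hu'.2, hu'.2])
  have d4 : Disjoint ((nonfixedRoots K q b).image (frobEsymmPair q))
      ((nonfixedRoots K q c).image (frobEsymmPair q)) := by
    rw [disjoint_left]
    intro p hp hp'
    obtain ⟨u, hu, rfl⟩ := mem_image.1 hp
    obtain ⟨u', hu', he⟩ := mem_image.1 hp'
    rw [mem_nonfixedRoots hb0] at hu
    rw [mem_nonfixedRoots hc0] at hu'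
    have hqq := pow_mul_self_eq_self hq hbq hu.1
    have hw := mul_inv_cancel₀ (hself hb0 hu.1)
    have hwq : ((u * u ^ q)⁻¹) ^ q = (u * u ^ q)⁻¹ := by
      rw [inv_pow, mul_pow, hqq, mul_comm]
    set w := (u * u ^ q)⁻¹
    have hw' : w * u * u ^ q = 1 := by linear_combination hw
    have hr : unitEsymmPair w u = unitEsymmPair u' (u' ^ q) :=
      (unitEsymmPair_rotate hw').symm.trans he.symm
    have hne {x : K} (hx : x ^ q ≠ x) : (x ^ q) ^ q ≠ x ^ q := fun h => hx (hinj h)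
    rcases eq_or_eq_or_eq_of_unitEsymmPair_eq (mul_pow_mul_pow_eq_one hcq hu'.1)
      (left_ne_zero_of_mul_eq_one hw') hr with e | e | e
    · exact hu'.2 (by rwa [e] at hwq)
    · exact hne hu'.2 (by rwa [e] at hwq)
    · exact hne (hne hu'.2) (by rwa [e] at hwq)
  rw [card_union_of_disjoint (disjoint_union_right.2 ⟨d1 hb0, disjoint_union_right.2 ⟨d1 hc0, d2⟩⟩),
    card_union_of_disjoint (disjoint_union_right.2 ⟨d4, d3 hb0⟩),
    card_union_of_disjoint (d3 hc0), card_image_fixedRoots hb0, card_fixedRoots hq hb]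
  have k1 := card_distinctPairs (K := K) ha
  have k2 := six_mul_card_image_distinctPairs (K := K) ha0
  have k3 := card_nonfixedRoots (K := K) hq hb
  have k4 := two_mul_card_image_nonfixedRoots (K := K) hq hb0 hbq
  have k5 := card_nonfixedRoots (K := K) hq hc
  have k6 := three_mul_card_image_nonfixedRoots (K := K) hinj hc0 hcq
  rw [← k2] at k1
  rw [← k4] at k3
  rw [← k6] at k5
  have k1' := congrArg (Nat.cast : ℕ → ℚ) k1
  have k3' := congrArg (Nat.cast : ℕ → ℚ) k3
  have k5' := congrArg (Nat.cast : ℕ → ℚ) k5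
  push_cast at k1' k3' k5' ⊢
  linarith

end Field

section Arithmetic

theorem gcd_div_gcd_sq_sub_one {q k a b : ℕ} (hq : 2 ≤ q) (hk : 0 < k)
    (ha : a = (q - 1) / Nat.gcd k (q - 1))
    (hb : b = (q ^ 2 - 1) / Nat.gcd k (q ^ 2 - 1)) :
    b.gcd (q - 1) = a + if 2 ∣ k ∧ 2 ∣ b then a else 0 := by
  obtain ⟨n, rfl⟩ : ∃ n, q = n + 1 := ⟨q - 1, by omega⟩
  have hN : (n + 1) ^ 2 - 1 = n * (n + 2) := by
    rw [show (n + 1) ^ 2 = n * (n + 2) + 1 by ring, Nat.add_sub_cancel]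
  rw [hN] at hb
  rw [show n + 1 - 1 = n from rfl] at ha ⊢
  have hn : 0 < n := by omega
  set d := k.gcd n
  set d' := k.gcd (n + 2)
  set e := k.gcd (n * (n + 2)) with he
  have hd0 : 0 < d := Nat.gcd_pos_of_pos_left _ hk
  have he0 : 0 < e := Nat.gcd_pos_of_pos_left _ hk
  have had : a * d = n := by rw [ha, Nat.div_mul_cancel (Nat.gcd_dvd_right _ _)]
  have hbe : b * e = n * (n + 2) := by rw [hb, Nat.div_mul_cancel (Nat.gcd_dvd_right _ _)]
  have ha0 : 0 < a := Nat.pos_of_ne_zero (by rintro rfl; omega)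
  have hed : e.gcd (n + 2) = d' := by
    rw [he, Nat.gcd_assoc, Nat.gcd_mul_left_left]
  obtain ⟨δ, hδ⟩ : e ∣ d * d' := Nat.gcd_mul_right_dvd_mul_gcd k n (n + 2)
  have hgcd : b.gcd n = a * δ := by
    apply Nat.eq_of_mul_eq_mul_left he0
    calc e * b.gcd n = (n * (n + 2)).gcd (n * e) := by
          rw [← Nat.gcd_mul_left, mul_comm e b, hbe, mul_comm e n]
      _ = n * d' := by rw [Nat.gcd_mul_left, Nat.gcd_comm, hed]
      _ = a * (d * d') := by rw [← mul_assoc, had]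
      _ = e * (a * δ) := by rw [hδ]; ring
  have hde : d ∣ e := Nat.gcd_dvd_gcd_mul_right_right _ _ _
  have hde' : d' ∣ e := Nat.gcd_dvd_gcd_mul_left_right _ _ _
  have hδdd : δ ∣ d.gcd d' := by
    obtain ⟨m, hm⟩ := Nat.lcm_dvd hde hde'
    have h1 := Nat.gcd_mul_lcm d d'
    have hl : 0 < d.lcm d' := Nat.pos_of_ne_zero (by intro h; rw [h] at hm; omega)
    refine ⟨m, Nat.eq_of_mul_eq_mul_right hl ?_⟩
    rw [h1, hδ, hm]
    ring
  have hδ2 : δ ∣ 2 := by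
    have h1 : δ ∣ n := (hδdd.trans (Nat.gcd_dvd_left _ _)).trans (Nat.gcd_dvd_right _ _)
    have h2 : δ ∣ n + 2 := (hδdd.trans (Nat.gcd_dvd_right _ _)).trans (Nat.gcd_dvd_right _ _)
    exact (Nat.dvd_add_right h1).1 h2
  rw [hgcd]
  rcases (Nat.dvd_prime Nat.prime_two).1 hδ2 with rfl | rfl
  · rw [if_neg, mul_one, add_zero]
    rintro ⟨h2k, h2b⟩
    have h2n : 2 ∣ n := by
      have h : 2 ∣ n * (n + 2) := hbe ▸ h2b.mul_right e
      rcases (Nat.Prime.dvd_mul Nat.prime_two).1 h with h | h <;> omega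
    have h2a : 2 ∣ a := by
      rw [mul_one] at hgcd
      exact hgcd ▸ Nat.dvd_gcd h2b h2n
    have h2d' : 2 ∣ d' := Nat.dvd_gcd h2k (by omega)
    have h1 : d * 2 ∣ k := by
      rw [mul_one] at hδ
      exact (mul_dvd_mul_left d h2d').trans (hδ ▸ Nat.gcd_dvd_left _ _)
    have h2 : d * 2 ∣ n := by
      rw [← had, mul_comm a d]
      exact mul_dvd_mul_left d h2a
    have := Nat.le_of_dvd hd0 (Nat.dvd_gcd h1 h2)
    omega
  · rw [if_pos, mul_two]
    refine ⟨((hδdd.trans (Nat.gcd_dvd_left _ _)).trans (Nat.gcd_dvd_left _ _)), ?_⟩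
    exact (Dvd.intro_left a rfl).trans (hgcd ▸ Nat.gcd_dvd_left b n)

theorem gcd_div_gcd_sq_add_add_one {q k a c : ℕ} (hq : 2 ≤ q)
    (ha : a = (q - 1) / Nat.gcd k (q - 1))
    (hc : c = (q ^ 2 + q + 1) / Nat.gcd k (q ^ 2 + q + 1)) :
    (Nat.gcd 3 a = c.gcd (q - 1) + if 3 ∣ k ∧ 3 ∣ a then 2 else 0) ∧ c.gcd (q - 1) ∣ a := by
  obtain ⟨n, rfl⟩ : ∃ n, q = n + 1 := ⟨q - 1, by omega⟩
  have hM : (n + 1) ^ 2 + (n + 1) + 1 = n * (n + 3) + 3 := by ring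
  rw [hM] at hc
  rw [show n + 1 - 1 = n from rfl] at ha ⊢
  set d := k.gcd n
  set f := k.gcd (n * (n + 3) + 3)
  have had : a * d = n := by rw [ha, Nat.div_mul_cancel (Nat.gcd_dvd_right _ _)]
  have hcf : c * f = n * (n + 3) + 3 := by
    rw [hc, Nat.div_mul_cancel (Nat.gcd_dvd_right _ _)]
  have h3 : c.gcd n ∣ 3 := by
    have h1 : c.gcd n ∣ n * (n + 3) + 3 := hcf ▸ (Nat.gcd_dvd_left c n).mul_right f
    exact (Nat.dvd_add_right ((Nat.gcd_dvd_right c n).mul_right _)).1 h1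
  have hcases : 3 ∣ c.gcd n ∧ c.gcd n = 3 ∨ ¬ 3 ∣ c.gcd n ∧ c.gcd n = 1 := by
    rcases (Nat.dvd_prime Nat.prime_three).1 h3 with h | h <;> rw [h] <;> norm_num
  have hcases' : 3 ∣ a ∧ Nat.gcd 3 a = 3 ∨ ¬ 3 ∣ a ∧ Nat.gcd 3 a = 1 := by
    by_cases h : 3 ∣ a
    · exact Or.inl ⟨h, Nat.gcd_eq_left h⟩
    · exact Or.inr ⟨h, (Nat.Prime.coprime_iff_not_dvd Nat.prime_three).2 h⟩
  by_cases h3n : 3 ∣ n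
  · have h9 : ¬ 9 ∣ n * (n + 3) + 3 := by
      obtain ⟨m, rfl⟩ := h3n
      rw [show 3 * m * (3 * m + 3) + 3 = 9 * (m * (m + 1)) + 3 by ring]
      omega
    by_cases h3k : 3 ∣ k
    · have h3f : 3 ∣ f := Nat.dvd_gcd h3k ((h3n.mul_right _).add (dvd_refl 3))
      have h3c : ¬ 3 ∣ c := fun h => h9 (hcf ▸ mul_dvd_mul h h3f)
      have h1 : c.gcd n = 1 := by
        rcases hcases with h | h
        · exact absurd (h.1.trans (Nat.gcd_dvd_left _ _)) h3c
        · exact h.2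
      rw [h1]
      refine ⟨?_, one_dvd a⟩
      rcases hcases' with h | h
      · rw [if_pos ⟨h3k, h.1⟩, h.2]
      · rw [if_neg (fun h' => h.1 h'.2), h.2]
    · have h3f : ¬ 3 ∣ f := fun h => h3k (h.trans (Nat.gcd_dvd_left _ _))
      have h3d : ¬ 3 ∣ d := fun h => h3k (h.trans (Nat.gcd_dvd_left _ _))
      have h3c : 3 ∣ c := by
        have : 3 ∣ c * f := hcf ▸ (h3n.mul_right _).add (dvd_refl 3)
        exact (Nat.prime_three.dvd_mul.1 this).resolve_right h3f
      have h3a : 3 ∣ a := by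
        have : 3 ∣ a * d := had ▸ h3n
        exact (Nat.prime_three.dvd_mul.1 this).resolve_right h3d
      rw [if_neg (fun h => h3k h.1)]
      rcases hcases with h | h
      · rw [h.2]
        exact ⟨Nat.gcd_eq_left h3a, h3a⟩
      · exact absurd (Nat.dvd_gcd h3c h3n) h.1
  · have h3a : ¬ 3 ∣ a := fun h => h3n (had ▸ h.mul_right d)
    rw [if_neg (fun h => h3a h.2)]
    rcases hcases with h | h
    · exact absurd (h.1.trans (Nat.gcd_dvd_right _ _)) h3n
    · rw [h.2]
      exact ⟨(Nat.Prime.coprime_iff_not_dvd Nat.prime_three).2 h3a, one_dvd a⟩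

theorem value_count_eq_sq_iff {q k a b c : ℕ} (hq : 2 ≤ q) (hk : 0 < k)
    (ha : a = (q - 1) / Nat.gcd k (q - 1))
    (hb : b = (q ^ 2 - 1) / Nat.gcd k (q ^ 2 - 1))
    (hc : c = (q ^ 2 + q + 1) / Nat.gcd k (q ^ 2 + q + 1)) :
    (a : ℚ) ^ 2 / 6 + (b : ℚ) / 2 + (c : ℚ) / 3 +
        ((if 3 ∣ k ∧ 3 ∣ a then (2 : ℚ) / 3 else 0) +
         (if 2 ∣ k ∧ 2 ∣ b then (a : ℚ) / 2 else 0)) = (q : ℚ) ^ 2 ↔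
      Nat.gcd k (q - 1) = 1 ∧ Nat.gcd k (q ^ 2 - 1) = 1 ∧ Nat.gcd k (q ^ 3 - 1) = 1 := by
  have hq2 : 1 ≤ q ^ 2 := Nat.one_le_pow _ _ (by omega)
  have had : a * k.gcd (q - 1) = q - 1 := by rw [ha, Nat.div_mul_cancel (Nat.gcd_dvd_right _ _)]
  have hbe : b * k.gcd (q ^ 2 - 1) = q ^ 2 - 1 := by
    rw [hb, Nat.div_mul_cancel (Nat.gcd_dvd_right _ _)]
  have hcf : c * k.gcd (q ^ 2 + q + 1) = q ^ 2 + q + 1 := by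
    rw [hc, Nat.div_mul_cancel (Nat.gcd_dvd_right _ _)]
  have hcube : q ^ 3 - 1 = (q - 1) * (q ^ 2 + q + 1) := by
    obtain ⟨n, rfl⟩ : ∃ n, q = n + 1 := ⟨q - 1, by omega⟩
    rw [Nat.add_sub_cancel, show (n + 1) ^ 3 = n * ((n + 1) ^ 2 + (n + 1) + 1) + 1 by ring,
      Nat.add_sub_cancel]
  have cast1 : ((q - 1 : ℕ) : ℚ) = q - 1 := by rw [Nat.cast_sub (by omega), Nat.cast_one]
  have cast2 : ((q ^ 2 - 1 : ℕ) : ℚ) = (q : ℚ) ^ 2 - 1 := by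
    rw [Nat.cast_sub hq2, Nat.cast_one, Nat.cast_pow]
  have hqQ : (2 : ℚ) ≤ q := by exact_mod_cast hq
  constructor
  · intro h
    have hle {m d n : ℕ} (hd : 0 < d) (hm : m * d = n) (r : ℕ) (hr : r ∣ d) :
        (r : ℚ) * m ≤ n := by
      rw [← hm]
      exact_mod_cast (by rw [mul_comm]; exact Nat.mul_le_mul_left m (Nat.le_of_dvd hd hr))
    have pos (n : ℕ) : 0 < k.gcd n := Nat.gcd_pos_of_pos_left _ hk
    have la := hle (pos _) had 1 (one_dvd _)
    have lb := hle (pos _) hbe 1 (one_dvd _)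
    have lc := hle (pos _) hcf 1 (one_dvd _)
    push_cast [cast1, cast2] at la lb lc
    rw [one_mul] at la lb lc
    have ha2 : (a : ℚ) ^ 2 ≤ ((q : ℚ) - 1) ^ 2 := pow_le_pow_left₀ (by positivity) la 2
    have l3 (h3 : 3 ∣ k ∧ 3 ∣ a) : 3 * (c : ℚ) ≤ (q : ℚ) ^ 2 + q + 1 := by
      have h3q : 3 ∣ q ^ 2 + q + 1 := by
        have h : 3 ∣ q - 1 := had ▸ h3.2.mul_right _
        obtain ⟨m, hm⟩ := h
        rw [show q = 3 * m + 1 by omega]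
        exact ⟨3 * m ^ 2 + 3 * m + 1, by ring⟩
      have := hle (pos _) hcf 3 (Nat.dvd_gcd h3.1 h3q)
      push_cast at this
      exact this
    have l2 (h2 : 2 ∣ k ∧ 2 ∣ b) : 2 * (b : ℚ) ≤ (q : ℚ) ^ 2 - 1 := by
      have := hle (pos _) hbe 2 (Nat.dvd_gcd h2.1 (hbe ▸ h2.2.mul_right _))
      push_cast [cast2] at this
      exact this
    split_ifs at h with h3 h2 h2
    · have := l3 h3
      have := l2 h2
      nlinarith
    · have := l3 h3
      nlinarith
    · have := l2 h2
      nlinarith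
    have one_of {m d n : ℕ} (hn : 0 < n) (hm : m * d = n) (hmn : (n : ℚ) ≤ m) : d = 1 := by
      have h1 : n ≤ m := by exact_mod_cast hmn
      have h2 : m * d = m * 1 := by
        have : m ≤ m * d := Nat.le_mul_of_pos_right m (Nat.pos_of_ne_zero (by rintro rfl; omega))
        omega
      exact Nat.eq_of_mul_eq_mul_left (by omega) h2
    have e1 : k.gcd (q - 1) = 1 := by
      refine one_of (by omega) had ?_
      rw [cast1]
      have : ((q : ℚ) - 1) ^ 2 ≤ (a : ℚ) ^ 2 := by nlinarith
      exact le_of_sq_le_sq this (by positivity)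
    have e2 : k.gcd (q ^ 2 - 1) = 1 := by
      refine one_of ?_ hbe ?_
      · have : 2 ^ 2 ≤ q ^ 2 := Nat.pow_le_pow_left hq 2
        omega
      · rw [cast2]
        nlinarith
    have e3 : k.gcd (q ^ 2 + q + 1) = 1 := by
      refine one_of (by positivity) hcf ?_
      push_cast
      nlinarith
    refine ⟨e1, e2, ?_⟩
    rw [hcube]
    exact Nat.Coprime.mul_right e1 e3
  · rintro ⟨h1, h2, h3⟩
    have h4 : k.gcd (q ^ 2 + q + 1) = 1 := by
      rw [hcube] at h3
      exact Nat.Coprime.coprime_mul_left_right h3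
    rw [h1, mul_one] at had
    rw [h2, mul_one] at hbe
    rw [h4, mul_one] at hcf
    have no {r n : ℕ} (hr : 1 < r) (h : k.gcd n = 1) : ¬ (r ∣ k ∧ r ∣ n) := by
      rintro ⟨h5, h6⟩
      have := Nat.dvd_gcd h5 h6
      rw [h, Nat.dvd_one] at this
      omega
    rw [had, hbe, hcf, if_neg (no (by norm_num) h1), if_neg (no (by norm_num) h2), cast1, cast2]
    push_cast
    ring

end Arithmetic

section FiniteField

open Polynomial

variable {F : Type*} [Field F] [Fintype F]

theorem exists_map_T_eq {K : Type*} [Field K] [Algebra F K] (k : ℕ) {u v w : K}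
    (h : u * v * w = 1)
    (he : esymmPair (u ^ Fintype.card F) (v ^ Fintype.card F) (w ^ Fintype.card F) =
      esymmPair u v w) :
    ∃ x : F × F, (algebraMap F K (T k x).1, algebraMap F K (T k x).2) =
      unitEsymmPair (u ^ k) (v ^ k) := by
  have hφ (x : K) : FiniteField.frobeniusAlgHom F K x = x ^ Fintype.card F := rfl
  simp only [esymmPair, Prod.mk.injEq] at he
  obtain ⟨x, hx⟩ := exists_algebraMap_eq_of_pow_card_eq (F := F) (x := u + v + w)
    (by rw [← hφ, map_add, map_add]; exact he.1)
  obtain ⟨y, hy⟩ := exists_algebraMap_eq_of_pow_card_eq (F := F) (x := u * v + v * w + w * u)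
    (by rw [← hφ, map_add, map_add, map_mul, map_mul, map_mul]; exact he.2)
  refine ⟨(x, y), ?_⟩
  rw [← map_T (algebraMap F K) k (x, y), hx, hy]
  rw [unitEsymmPair_eq_esymmPair (w := w ^ k) (by rw [← mul_pow, ← mul_pow, h, one_pow]),
    ← T_esymmPair k u v w h, esymmPair]

theorem map_T_mem_rootPoints {K : Type*} [Field K] [DecidableEq K] [IsAlgClosed K] [Algebra F K]
    {k a b c : ℕ} (hk : 0 < k) (ha0 : 0 < a) (hb0 : 0 < b) (hc0 : 0 < c)
    (ha : a = (Fintype.card F - 1) / Nat.gcd k (Fintype.card F - 1))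
    (hb : b = (Fintype.card F ^ 2 - 1) / Nat.gcd k (Fintype.card F ^ 2 - 1))
    (hc : c = (Fintype.card F ^ 2 + Fintype.card F + 1) /
      Nat.gcd k (Fintype.card F ^ 2 + Fintype.card F + 1)) (x : F × F) :
    (algebraMap F K (T k x).1, algebraMap F K (T k x).2) ∈
      rootPoints K (Fintype.card F) a b c := by
  have hφ (y : K) : FiniteField.frobeniusAlgHom F K y = y ^ Fintype.card F := rfl
  have hq : 0 < Fintype.card F := Fintype.card_pos
  obtain ⟨u, v, w, h, he⟩ := exists_esymmPair_eq (algebraMap F K x.1, algebraMap F K x.2)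
  rw [← map_T (algebraMap F K) k x, ← he, T_esymmPair k u v w h]
  have hfrob : esymmPair (u ^ Fintype.card F) (v ^ Fintype.card F) (w ^ Fintype.card F) =
      esymmPair u v w := by
    simp only [esymmPair, Prod.mk.injEq] at he
    simp only [esymmPair, ← hφ, ← map_mul, ← map_add]
    rw [he.1, he.2, AlgHom.commutes, AlgHom.commutes]
  have hpow : u ^ Fintype.card F * v ^ Fintype.card F * w ^ Fintype.card F = 1 := by
    rw [← mul_pow, ← mul_pow, h, one_pow]
  have hcases := esymmPair_eq_cases h hpow hfrob
  have h0 : u * v ≠ 0 := left_ne_zero_of_mul_eq_one h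
  have hu0 : u ≠ 0 := left_ne_zero_of_mul h0
  have hv0 : v ≠ 0 := right_ne_zero_of_mul h0
  have hk1 {u v w : K} (h : u * v * w = 1) : u ^ k * v ^ k * w ^ k = 1 := by
    rw [← mul_pow, ← mul_pow, h, one_pow]
  generalize Fintype.card F = q at *
  have split {y : K} (hy0 : y ≠ 0) (hy : y ^ q = y) : (y ^ k) ^ a = 1 := by
    rw [ha, ← exists_pow_eq_iff hk]
    refine ⟨y, ?_, rfl⟩
    rw [← Nat.sub_add_cancel hq, pow_succ] at hy
    exact (mul_eq_right₀ hy0).1 hy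
  have quad {y z : K} (hy0 : y ≠ 0) (hy : y ^ q = z) (hz : z ^ q = y) :
      unitEsymmPair (y ^ k) (z ^ k) ∈ rootPoints K q a b c := by
    refine Finset.mem_union_left _ (Finset.mem_union_right _ (Finset.mem_image.2 ⟨y ^ k, ?_, ?_⟩))
    · rw [mem_nthRootsFinset hb0, hb, ← exists_pow_eq_iff hk]
      refine ⟨y, ?_, rfl⟩
      have : y ^ q ^ 2 = y := by rw [pow_two, pow_mul, hy, hz]
      rw [← Nat.sub_add_cancel (Nat.one_le_pow 2 q hq), pow_succ] at this
      exact (mul_eq_right₀ hy0).1 this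
    · rw [frobEsymmPair, ← pow_mul, mul_comm, pow_mul, hy]
  have cubic {y z t : K} (h : y * z * t = 1) (hy : y ^ q = z) (hz : z ^ q = t) :
      unitEsymmPair (y ^ k) (z ^ k) ∈ rootPoints K q a b c := by
    refine Finset.mem_union_right _ (Finset.mem_image.2 ⟨y ^ k, ?_, ?_⟩)
    · rw [mem_nthRootsFinset hc0, hc, ← exists_pow_eq_iff hk]
      refine ⟨y, ?_, rfl⟩
      rw [← h, ← hz, ← hy]
      ring
    · rw [frobEsymmPair, ← pow_mul, mul_comm, pow_mul, hy]
  have huvw := unitEsymmPair_eq_esymmPair (hk1 h)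
  have hwu := unitEsymmPair_rotate (hk1 h)
  have huw : unitEsymmPair (u ^ k) (w ^ k) = unitEsymmPair (u ^ k) (v ^ k) := by
    rw [unitEsymmPair_swap, ← hwu]
    exact unitEsymmPair_rotate (hk1 (by linear_combination h))
  rw [← huvw]
  rcases hcases with e | e | e | e | e | e
  · refine Finset.mem_union_left _ (Finset.mem_union_left _
      (Finset.mem_image.2 ⟨(u ^ k, v ^ k), ?_, rfl⟩))
    rw [Finset.mem_product, mem_nthRootsFinset ha0, mem_nthRootsFinset ha0]
    exact ⟨split hu0 e.1, split hv0 e.2.1⟩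
  · rw [← hwu]
    exact quad hv0 e.2.1 e.2.2
  · exact quad hu0 e.1 e.2.1
  · exact cubic h e.1 e.2.1
  · rw [← huw]
    exact cubic (by linear_combination h) e.1 e.2.2
  · rw [← huw]
    exact quad hu0 e.1 e.2.2

theorem exists_map_T_eq_of_mem_rootPoints {K : Type*} [Field K] [DecidableEq K] [IsAlgClosed K]
    [Algebra F K] {k a b c : ℕ} (hk : 0 < k) (ha0 : 0 < a) (hb0 : 0 < b) (hc0 : 0 < c)
    (ha : a = (Fintype.card F - 1) / Nat.gcd k (Fintype.card F - 1))
    (hb : b = (Fintype.card F ^ 2 - 1) / Nat.gcd k (Fintype.card F ^ 2 - 1))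
    (hc : c = (Fintype.card F ^ 2 + Fintype.card F + 1) /
      Nat.gcd k (Fintype.card F ^ 2 + Fintype.card F + 1)) {p : K × K}
    (hp : p ∈ rootPoints K (Fintype.card F) a b c) :
    ∃ x : F × F, (algebraMap F K (T k x).1, algebraMap F K (T k x).2) = p := by
  have hq : 1 < Fintype.card F := Fintype.one_lt_card
  rw [rootPoints, Finset.mem_union, Finset.mem_union] at hp
  rcases hp with (hp | hp) | hp
  · obtain ⟨⟨u, v⟩, huv, rfl⟩ := Finset.mem_image.1 hp
    rw [Finset.mem_product, mem_nthRootsFinset ha0, mem_nthRootsFinset ha0, ha,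
      ← exists_pow_eq_iff hk, ← exists_pow_eq_iff hk] at huv
    obtain ⟨⟨y, hy, hyu⟩, z, hz, hzv⟩ := huv
    have fixed {y : K} (hy : y ^ (Fintype.card F - 1) = 1) : y ^ Fintype.card F = y := by
      rw [← Nat.sub_add_cancel hq.le, pow_succ, hy, one_mul]
    have hpos : 0 < Fintype.card F - 1 := by omega
    obtain ⟨x, hx⟩ := exists_map_T_eq (F := F) k (mul_inv_cancel₀
      (mul_ne_zero (ne_zero_of_pow_eq_one_of_pos hpos hy) (ne_zero_of_pow_eq_one_of_pos hpos hz)))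
      (by rw [inv_pow, mul_pow, fixed hy, fixed hz])
    exact ⟨x, by rw [hx, hyu, hzv]⟩
  · obtain ⟨u, hu, rfl⟩ := Finset.mem_image.1 hp
    rw [mem_nthRootsFinset hb0, hb, ← exists_pow_eq_iff hk] at hu
    obtain ⟨y, hy, rfl⟩ := hu
    have hpos : 0 < Fintype.card F ^ 2 - 1 := by
      have := Nat.one_lt_pow two_ne_zero hq
      omega
    have hqq := pow_mul_self_eq_self (zero_lt_one.trans hq) (dvd_refl _) hy
    have hy0 := ne_zero_of_pow_eq_one_of_pos hpos hy
    obtain ⟨x, hx⟩ := exists_map_T_eq (F := F) k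
      (mul_inv_cancel₀ (mul_ne_zero hy0 (pow_ne_zero (Fintype.card F) hy0)))
      (by rw [inv_pow, mul_pow, hqq, esymmPair_swap, mul_comm])
    exact ⟨x, by rw [hx, frobEsymmPair, ← pow_mul, ← pow_mul, mul_comm k]⟩
  · obtain ⟨u, hu, rfl⟩ := Finset.mem_image.1 hp
    rw [mem_nthRootsFinset hc0, hc, ← exists_pow_eq_iff hk] at hu
    obtain ⟨y, hy, rfl⟩ := hu
    have h1 := mul_pow_mul_pow_eq_one (dvd_refl _) hy
    have h2 := mul_pow_mul_pow_eq_one (n := Fintype.card F ^ 2 + Fintype.card F + 1)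
      (u := y ^ Fintype.card F) (dvd_refl _)
      (by rw [← pow_mul, mul_comm, pow_mul, hy, one_pow])
    have hqqq : ((y ^ Fintype.card F) ^ Fintype.card F) ^ Fintype.card F = y := by
      apply mul_left_cancel₀ (left_ne_zero_of_mul_eq_one h2)
      rw [h2, ← h1]
      ring
    obtain ⟨x, hx⟩ := exists_map_T_eq (F := F) k h1 (by rw [hqqq, esymmPair_rotate])
    exact ⟨x, by rw [hx, frobEsymmPair, ← pow_mul, ← pow_mul, mul_comm k]⟩

end FiniteField

theorem value_set_bivariate_chebyshev (F : Type*) [Field F] [Fintype F]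
    (q : ℕ) (hq : q = Fintype.card F) (k : ℕ) (hk : 0 < k)
    (a b c : ℕ)
    (ha : a = (q - 1) / Nat.gcd k (q - 1))
    (hb : b = (q ^ 2 - 1) / Nat.gcd k (q ^ 2 - 1))
    (hc : c = (q ^ 2 + q + 1) / Nat.gcd k (q ^ 2 + q + 1)) :
    ((Set.range (T k : F × F → F × F)).ncard : ℚ) =
      (a : ℚ) ^ 2 / 6 + (b : ℚ) / 2 + (c : ℚ) / 3 +
        ((if 3 ∣ k ∧ 3 ∣ a then (2 : ℚ) / 3 else 0) +
         (if 2 ∣ k ∧ 2 ∣ b then (a : ℚ) / 2 else 0)) ∧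
    (Function.Bijective (T k : F × F → F × F) ↔
      Nat.gcd k (q - 1) = 1 ∧ Nat.gcd k (q ^ 2 - 1) = 1 ∧ Nat.gcd k (q ^ 3 - 1) = 1) := by
  classical
  subst hq
  have hq : 1 < Fintype.card F := Fintype.one_lt_card
  have hq2 : 1 < Fintype.card F ^ 2 := Nat.one_lt_pow two_ne_zero hq
  have hab := gcd_div_gcd_sq_sub_one hq hk ha hb
  obtain ⟨hac, hca⟩ := gcd_div_gcd_sq_add_add_one hq ha hc
  have hiff := value_count_eq_sq_iff hq hk ha hb hc
  let K := AlgebraicClosure F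
  have ha' : a ∣ Fintype.card F - 1 := ha ▸ Nat.div_dvd_of_dvd (Nat.gcd_dvd_right _ _)
  have hb' : b ∣ Fintype.card F ^ 2 - 1 := hb ▸ Nat.div_dvd_of_dvd (Nat.gcd_dvd_right _ _)
  have hc' : c ∣ Fintype.card F ^ 2 + Fintype.card F + 1 :=
    hc ▸ Nat.div_dvd_of_dvd (Nat.gcd_dvd_right _ _)
  have hcard : (Fintype.card F : K) = 0 := by
    rw [← map_natCast (algebraMap F K), FiniteField.cast_card_eq_zero, map_zero]
  have cast_ne {m n : ℕ} (h : m ∣ n) (hn : (n : K) ≠ 0) : (m : K) ≠ 0 := by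
    obtain ⟨r, rfl⟩ := h
    rw [Nat.cast_mul] at hn
    exact left_ne_zero_of_mul hn
  have haK : (a : K) ≠ 0 := cast_ne ha' (by rw [Nat.cast_sub hq.le, hcard]; simp)
  have hbK : (b : K) ≠ 0 :=
    cast_ne hb' (by rw [Nat.cast_sub hq2.le, Nat.cast_pow, hcard]; simp)
  have hcK : (c : K) ≠ 0 := cast_ne hc' (by simp [hcard])
  have pos {n : ℕ} (hn : (n : K) ≠ 0) : 0 < n :=
    Nat.pos_of_ne_zero (by rintro rfl; exact hn Nat.cast_zero)
  have habdvd : a ∣ b := by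
    have h : a ∣ b.gcd (Fintype.card F - 1) := by
      rw [hab]
      split_ifs
      · exact (dvd_refl a).add (dvd_refl a)
      · exact dvd_rfl
    exact h.trans (Nat.gcd_dvd_left _ _)
  have himage : (Prod.map (algebraMap F K) (algebraMap F K)) '' Set.range (T k : F × F → F × F) =
      rootPoints K (Fintype.card F) a b c := by
    ext p
    constructor
    · rintro ⟨_, ⟨x, rfl⟩, rfl⟩
      exact map_T_mem_rootPoints hk (pos haK) (pos hbK) (pos hcK) ha hb hc x
    · intro hp
      obtain ⟨x, hx⟩ := exists_map_T_eq_of_mem_rootPoints (F := F) hk (pos haK) (pos hbK) (pos hcK)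
        ha hb hc hp
      exact ⟨T k x, ⟨x, rfl⟩, hx⟩
  have hinj := (algebraMap F K).injective
  have hcount : ((Set.range (T k : F × F → F × F)).ncard : ℚ) =
      (a : ℚ) ^ 2 / 6 + (b : ℚ) / 2 + (c : ℚ) / 3 +
        ((if 3 ∣ k ∧ 3 ∣ a then (2 : ℚ) / 3 else 0) +
         (if 2 ∣ k ∧ 2 ∣ b then (a : ℚ) / 2 else 0)) := by
    rw [← Set.ncard_image_of_injective _ (hinj.prodMap hinj), himage, Set.ncard_coe_finset,
      card_rootPoints (zero_lt_one.trans hq) (FiniteField.frobeniusAlgHom F K).toRingHom.injective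
        haK hbK hcK habdvd ha' hb' hc' (hca.trans habdvd), hab, hac]
    push_cast
    split_ifs <;> ring
  refine ⟨hcount, ?_⟩
  rw [← hiff, ← hcount, ← Finite.surjective_iff_bijective, ← Set.range_eq_univ,
    Set.eq_univ_iff_ncard, Nat.card_prod, Nat.card_eq_fintype_card, ← pow_two]
  norm_cast
end
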